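/- Fix r ≥ 1 and an r-core γ. Then Σ_{λ} G_λ(q,X)·G̃_λ(q,Y) = Π_{i,j ∈ ℕ} Π_{k=0}^{r−1} (1 + q^k X_i Y_j), where the sum is over partitions λ in the r-rim hook lattice of γ, G_λ(q,X) = Σ_P q^{2·spin(P)} X^{wt(P)} sums over semistandard r-ribbon tableaux P of shape λ/γ, and G̃_λ(q,Y) = Σ_Q q^{2·spinᵛ(Q)} Y^{wt(Q)} sums over transpose semistandard r-ribbon tableaux Q of shape λ/γ. -/

import Mathlib

open scoped Classical

/-- A doubly infinite bit sequence: a function `ℤ → ℕ` with all values `≤ 1`. -/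
def IsBitSeq (s : ℤ → ℕ) : Prop := ∀ i, s i ≤ 1

/-- The quadruple `(w (i-r), t (i-r), s i, w i)` equals `(1,0,0,1)`:
the strip `t/s` with witness `w` has an `r`-ribbon at position `i`. -/
def Quad (r : ℕ) (s t w : ℤ → ℕ) (i : ℤ) : Prop :=
  w (i - r) = 1 ∧ t (i - r) = 0 ∧ s i = 0 ∧ w i = 1

/-- `w` is a witness for `t/s` being a horizontal `r`-ribbon strip: for every `i`, the
quadruple `(w (i-r), t (i-r), s i, w i)` is of the form `(a,a,b,b)` or equals `(1,0,0,1)`,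
the latter happening only finitely often. -/
def IsWitness (r : ℕ) (s t w : ℤ → ℕ) : Prop :=
  (∀ i : ℤ, (w (i - r) = t (i - r) ∧ s i = w i) ∨ Quad r s t w i) ∧
    {i : ℤ | Quad r s t w i}.Finite

/-- `t/s` is a horizontal `r`-ribbon strip (`s ≤ʰᵣ t`). -/
def HStrip (r : ℕ) (s t : ℤ → ℕ) : Prop := ∃ w, IsWitness r s t w

/-- The height `∑_{j=1}^{r-1} w (i - j)` of a ribbon at position `i` read off from `w`. -/
def hgtAt (r : ℕ) (w : ℤ → ℕ) (i : ℤ) : ℕ := ∑ j ∈ Finset.Ico 1 r, w (i - (j : ℤ))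

/-- The witness of a horizontal `r`-ribbon strip (it is unique). -/
noncomputable def theWitness (r : ℕ) (s t : ℤ → ℕ) : ℤ → ℕ :=
  if h : HStrip r s t then h.choose else s

/-- The strip `t/s` has a ribbon at position (head diagonal) `i`. -/
def RibbonAt (r : ℕ) (s t : ℤ → ℕ) (i : ℤ) : Prop :=
  Quad r s t (theWitness r s t) i

/-- The number of `r`-ribbons of the strip `t/s`. -/
noncomputable def ribCount (r : ℕ) (s t : ℤ → ℕ) : ℕ :=
  {i : ℤ | RibbonAt r s t i}.ncard

/-- Twice the spin of the horizontal `r`-ribbon strip `t/s`: the total height of the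
ribbons of its standardisation. -/
noncomputable def twoSpin (r : ℕ) (s t : ℤ → ℕ) : ℕ :=
  ∑ᶠ i ∈ {i : ℤ | RibbonAt r s t i}, hgtAt r (theWitness r s t) i

/-- A partition: a weakly decreasing, eventually zero function `ℕ → ℕ`. -/
def IsPartition (f : ℕ → ℕ) : Prop :=
  (∀ i j : ℕ, i ≤ j → f j ≤ f i) ∧ ∃ N : ℕ, ∀ n : ℕ, N ≤ n → f n = 0

/-- The edge sequence of a partition: bit `1` exactly at the positions `f j - j - 1`
(for `j : ℕ`); it is eventually `1` to the left and `0` to the right, and adding a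
square on diagonal `k` replaces the substring `10` at positions `(k-1, k)` by `01`. -/
noncomputable def edgeSeq (f : ℕ → ℕ) (k : ℤ) : ℕ :=
  if ∃ j : ℕ, (f j : ℤ) - (j : ℤ) - 1 = k then 1 else 0

/-- A vector in `ℕ^r`, encoded as a function `ℕ → ℕ` supported on `{0, …, r-1}`. -/
def Supported (r : ℕ) (a : ℕ → ℕ) : Prop := ∀ h : ℕ, r ≤ h → a h = 0

/-- A semistandard `r`-ribbon tableau built on `γ`: a chain of horizontal `r`-ribbon
strips starting at `γ` (indexed by `ℕ`; steps with no ribbons leave the shape fixed). -/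
def IsSSRT (r : ℕ) (γ : ℕ → ℕ) (c : ℕ → ℕ → ℕ) : Prop :=
  c 0 = γ ∧ (∀ i, IsPartition (c i)) ∧
    ∀ i : ℕ, HStrip r (edgeSeq (c i)) (edgeSeq (c (i + 1)))

/-- Twice the spin of a semistandard `r`-ribbon tableau: the sum of the total heights of
its horizontal `r`-ribbon strips. -/
noncomputable def chainTwoSpin (r : ℕ) (c : ℕ → ℕ → ℕ) : ℕ :=
  ∑ᶠ i : ℕ, twoSpin r (edgeSeq (c i)) (edgeSeq (c (i + 1)))

/-- The weight of a semistandard `r`-ribbon tableau: the numbers of ribbons in its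
successive strips. -/
noncomputable def chainWt (r : ℕ) (c : ℕ → ℕ → ℕ) (i : ℕ) : ℕ :=
  ribCount r (edgeSeq (c i)) (edgeSeq (c (i + 1)))

/-- `|a| = Σ_{h<r} a h` for a vector `a ∈ ℕʳ`. -/
def vnorm (r : ℕ) (v : ℕ → ℕ) : ℕ := ∑ h ∈ Finset.range r, v h

/-- `n(a) = Σ_{h<r} h·a h` for a vector `a ∈ ℕʳ`. -/
def vcolor (r : ℕ) (v : ℕ → ℕ) : ℕ := ∑ h ∈ Finset.range r, h * v h

/-- Transposition on edge sequences: reverse and complement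
(`edge(λᵀ) = revc (edge λ)`). -/
def revc (s : ℤ → ℕ) : ℤ → ℕ := fun i => 1 - s (-1 - i)

/-- `t/s` is a vertical `r`-ribbon strip: its transpose is a horizontal one. -/
def VStrip (r : ℕ) (s t : ℤ → ℕ) : Prop := HStrip r (revc s) (revc t)

/-- The vertical `r`-ribbon strip `t/s` has, in its standardisation (ribbons added by
decreasing head diagonal), a ribbon with head on diagonal `k`. -/
def VRibbonAt (r : ℕ) (s t : ℤ → ℕ) (k : ℤ) : Prop :=
  RibbonAt r (revc s) (revc t) ((r : ℤ) - 1 - k)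

/-- Twice the spin of a vertical `r`-ribbon strip: the sum of the heights (in the
original, untransposed orientation) of the ribbons of its standardisation. -/
noncomputable def twoSpinV (r : ℕ) (s t : ℤ → ℕ) : ℕ :=
  ∑ᶠ q ∈ {q : ℤ | RibbonAt r (revc s) (revc t) q},
    (r - 1 - hgtAt r (theWitness r (revc s) (revc t)) q)

/-- A transpose semistandard `r`-ribbon tableau built on `γ`: a chain of vertical
`r`-ribbon strips starting at `γ`. -/
def IsTSSRT (r : ℕ) (γ : ℕ → ℕ) (c : ℕ → ℕ → ℕ) : Prop :=
  c 0 = γ ∧ (∀ i, IsPartition (c i)) ∧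
    ∀ i : ℕ, VStrip r (edgeSeq (c i)) (edgeSeq (c (i + 1)))

/-- Twice the spin of a transpose semistandard `r`-ribbon tableau. -/
noncomputable def chainTwoSpinV (r : ℕ) (c : ℕ → ℕ → ℕ) : ℕ :=
  ∑ᶠ i : ℕ, twoSpinV r (edgeSeq (c i)) (edgeSeq (c (i + 1)))

/-- The weight of a transpose semistandard `r`-ribbon tableau. -/
noncomputable def chainWtV (r : ℕ) (c : ℕ → ℕ → ℕ) (i : ℕ) : ℕ :=
  ribCount r (revc (edgeSeq (c i))) (revc (edgeSeq (c (i + 1))))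


open Polynomial in
/-- The Fock space: finite combinations of doubly infinite bit sequences. -/
abbrev Fock := (ℤ → Bool) →₀ ℕ[X]

/-- The `ℕ`-valued bit sequence of a `Bool`-valued one. -/
def bits (s : ℤ → Bool) : ℤ → ℕ := fun i => (s i).toNat

/-- Move a `1` from position `j - r` to position `j`, with weight `X ^ ω h` where `h` is the number
of `1`s in between. -/
noncomputable def hop (r : ℕ) (ω : ℕ → ℕ) (j : ℤ) : Module.End (Polynomial ℕ) Fock :=
  Finsupp.linearCombination (Polynomial ℕ) fun s : ℤ → Bool =>
    if s (j - r) = true ∧ s j = false then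
      Finsupp.single (s ∘ Equiv.swap (j - r) j)
        ((Polynomial.X : Polynomial ℕ) ^ ω (hgtAt r (bits s) j))
    else 0

/-- Complementation of bit sequences, on the Fock space. -/
noncomputable def complOp : Module.End (Polynomial ℕ) Fock :=
  Finsupp.lmapDomain (Polynomial ℕ) (Polynomial ℕ) fun s i => !s i

/-- Adding an `r`-ribbon with head on diagonal `j`. -/
noncomputable def raiseOp (r : ℕ) (j : ℤ) : Module.End (Polynomial ℕ) Fock := hop r id j

/-- Removing an `r`-ribbon with head on diagonal `j`. -/
noncomputable def lowerOp (r : ℕ) (j : ℤ) : Module.End (Polynomial ℕ) Fock :=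
  complOp * hop r (fun h => r - 1 - h) j * complOp

/-- The degree `a` part of the ordered product of the `1 + g j` for `l < j ≤ l + n`, where smaller
indices act first. -/
noncomputable def scan {A : Type*} [Semiring A] (g : ℤ → A) (l : ℤ) : ℕ → ℤ → A
  | 0, a => if a = 0 then 1 else 0
  | n + 1, a => scan g l n a + g (l + n + 1) * scan g l n (a - 1)

/-- The number of `1`s among the bits at positions `j - r + 1, …, j`. -/
def windowSum (r : ℕ) (s : ℤ → Bool) (j : ℤ) : ℕ := ∑ k ∈ Finset.range r, bits s (j - k)

/-- The coefficient of `Z ^ c` in `∏ k < M, (1 + X ^ (2 k) Z)`. -/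
noncomputable def prodCoeff : ℕ → ℕ → Polynomial ℕ
  | _, 0 => 1
  | 0, _ + 1 => 0
  | M + 1, c + 1 => prodCoeff M (c + 1) + Polynomial.X ^ (2 * M) * prodCoeff M c

/-- The diagonal operator scaling each bit sequence by the coefficient of its window. -/
noncomputable def windowOp (r : ℕ) (j : ℤ) (c : ℕ) : Module.End (Polynomial ℕ) Fock :=
  Finsupp.linearCombination (Polynomial ℕ) fun s : ℤ → Bool =>
    Finsupp.single s (prodCoeff (windowSum r s j) c)

lemma complOp_single (s : ℤ → Bool) (p : Polynomial ℕ) :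
    complOp (Finsupp.single s p) = Finsupp.single (fun i => !s i) p := by
  simp [complOp, Finsupp.lmapDomain_apply, Finsupp.mapDomain_single]

lemma complOp_mul_complOp : complOp * complOp = 1 := by
  refine Finsupp.lhom_ext fun s p => ?_
  simp [complOp_single]

lemma hop_single (r : ℕ) (ω : ℕ → ℕ) (j : ℤ) (s : ℤ → Bool) (p : Polynomial ℕ) :
    hop r ω j (Finsupp.single s p) = if s (j - r) = true ∧ s j = false then
      Finsupp.single (s ∘ Equiv.swap (j - r) j) (p * Polynomial.X ^ ω (hgtAt r (bits s) j))
    else 0 := by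
  rw [hop, Finsupp.linearCombination_single]
  split_ifs <;> simp

lemma raiseOp_single (r : ℕ) (j : ℤ) (s : ℤ → Bool) (p : Polynomial ℕ) :
    raiseOp r j (Finsupp.single s p) = if s (j - r) = true ∧ s j = false then
      Finsupp.single (s ∘ Equiv.swap (j - r) j) (p * Polynomial.X ^ hgtAt r (bits s) j)
    else 0 := hop_single r id j s p

lemma hgtAt_not_add (r : ℕ) (j : ℤ) (s : ℤ → Bool) :
    hgtAt r (bits fun i => !s i) j + hgtAt r (bits s) j = r - 1 := by
  rw [hgtAt, hgtAt, ← Finset.sum_add_distrib, ← Nat.card_Ico 1 r, Finset.card_eq_sum_ones]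
  refine Finset.sum_congr rfl fun k _ => ?_
  simp only [bits]
  cases s (j - k) <;> rfl

lemma lowerOp_single (r : ℕ) (j : ℤ) (s : ℤ → Bool) (p : Polynomial ℕ) :
    lowerOp r j (Finsupp.single s p) = if s (j - r) = false ∧ s j = true then
      Finsupp.single (s ∘ Equiv.swap (j - r) j) (p * Polynomial.X ^ hgtAt r (bits s) j)
    else 0 := by
  have h := hgtAt_not_add r j s
  rw [lowerOp, Module.End.mul_apply, Module.End.mul_apply, complOp_single, hop_single]
  have h2 : r - 1 - hgtAt r (bits fun i => !s i) j = hgtAt r (bits s) j := by omega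
  by_cases h1 : s (j - r) = false ∧ s j = true
  · simp only [h1, h2]
    simp only [Bool.not_false, Bool.not_true, and_self, if_true, complOp_single]
    congr 1
    funext i
    simp
  · have h3 : ¬ ((!s (j - r)) = true ∧ (!s j) = false) := by simpa using h1
    simp only [h1, h3, if_false, map_zero]

lemma windowOp_single (r : ℕ) (j : ℤ) (c : ℕ) (s : ℤ → Bool) (p : Polynomial ℕ) :
    windowOp r j c (Finsupp.single s p) =
      Finsupp.single s (p * prodCoeff (windowSum r s j) c) := by
  rw [windowOp, Finsupp.linearCombination_single]
  simp

lemma hgtAt_eq_sum (r : ℕ) (w : ℤ → ℕ) (j : ℤ) :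
    hgtAt r w j = ∑ i ∈ Finset.Ioo (j - r) j, w i := by
  refine Finset.sum_bij' (fun k _ => j - (k : ℤ)) (fun i _ => (j - i).toNat) ?_ ?_ ?_ ?_ ?_ <;>
    intro a ha <;> simp only [Finset.mem_Ico, Finset.mem_Ioo] at * <;> omega

lemma windowSum_eq (r : ℕ) (hr : 1 ≤ r) (s : ℤ → Bool) (j : ℤ) :
    windowSum r s j = hgtAt r (bits s) j + bits s j := by
  rw [windowSum, hgtAt, Finset.range_eq_Ico, Finset.sum_eq_sum_Ico_succ_bot (by omega)]
  simp [add_comm]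

lemma windowSum_pred_eq (r : ℕ) (hr : 1 ≤ r) (s : ℤ → Bool) (j : ℤ) :
    windowSum r s (j - 1) = hgtAt r (bits s) j + bits s (j - r) := by
  have : windowSum r s (j - 1) = ∑ k ∈ Finset.Ico 1 (r + 1), bits s (j - (k : ℤ)) := by
    rw [windowSum, Finset.sum_Ico_eq_sum_range]
    refine Finset.sum_congr (by simp) fun k _ => ?_
    congr 1
    push_cast
    ring
  rw [this, Finset.sum_Ico_succ_top hr, hgtAt]

lemma hgtAt_swap_of_notMem (r : ℕ) (s : ℤ → Bool) (j a b : ℤ)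
    (ha : a ∉ Finset.Ioo (j - r) j) (hb : b ∉ Finset.Ioo (j - r) j) :
    hgtAt r (bits (s ∘ Equiv.swap a b)) j = hgtAt r (bits s) j := by
  simp only [hgtAt_eq_sum]
  refine Finset.sum_congr rfl fun i hi => ?_
  have h1 : i ≠ a := by rintro rfl; exact ha hi
  have h2 : i ≠ b := by rintro rfl; exact hb hi
  simp [bits, Equiv.swap_apply_of_ne_of_ne h1 h2]

lemma hgtAt_swap_of_mem (r : ℕ) (s : ℤ → Bool) (j a b : ℤ)
    (ha : a ∈ Finset.Ioo (j - r) j) (hb : b ∉ Finset.Ioo (j - r) j) :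
    hgtAt r (bits (s ∘ Equiv.swap a b)) j + bits s a = hgtAt r (bits s) j + bits s b := by
  simp only [hgtAt_eq_sum]
  rw [← Finset.sum_erase_add _ _ ha, ← Finset.sum_erase_add _ (bits s) ha]
  have : ∑ x ∈ (Finset.Ioo (j - r) j).erase a, bits (s ∘ Equiv.swap a b) x =
      ∑ x ∈ (Finset.Ioo (j - r) j).erase a, bits s x := by
    refine Finset.sum_congr rfl fun i hi => ?_
    have h1 : i ≠ a := Finset.ne_of_mem_erase hi
    have h2 : i ≠ b := by rintro rfl; exact hb (Finset.mem_of_mem_erase hi)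
    simp [bits, Equiv.swap_apply_of_ne_of_ne h1 h2]
  rw [this]
  simp only [bits, Function.comp, Equiv.swap_apply_left]
  ring

lemma hgtAt_swap_self (r : ℕ) (s : ℤ → Bool) (j : ℤ) :
    hgtAt r (bits (s ∘ Equiv.swap (j - r) j)) j = hgtAt r (bits s) j :=
  hgtAt_swap_of_notMem r s j _ _ (by simp) (by simp)

lemma comp_swap_comm (s : ℤ → Bool) {a b c d : ℤ} (hac : a ≠ c) (had : a ≠ d) (hbc : b ≠ c)
    (hbd : b ≠ d) :
    (s ∘ Equiv.swap a b) ∘ Equiv.swap c d = (s ∘ Equiv.swap c d) ∘ Equiv.swap a b := by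
  funext i
  simp only [Function.comp, Equiv.swap_apply_def]
  split_ifs <;> simp_all

lemma raiseOp_lowerOp_comm (r : ℕ) (hr : 1 ≤ r) {m n : ℤ} (hmn : m ≠ n) :
    Commute (raiseOp r n) (lowerOp r m) := by
  refine Finsupp.lhom_ext fun s p => ?_
  rw [Module.End.mul_apply, Module.End.mul_apply, lowerOp_single, raiseOp_single]
  rcases eq_or_ne m (n - r) with h | h
  · subst h
    have e1 : n - r - r ≠ n := by omega
    have e2 : n - r - r ≠ n - r := by omega
    have e3 : n ≠ n - r := by omega
    split_ifs <;>
      simp_all [lowerOp_single, raiseOp_single, -Finsupp.single_mul,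
        Equiv.swap_apply_of_ne_of_ne e1.symm e3, Equiv.swap_apply_of_ne_of_ne e2 e1]
  rcases eq_or_ne (m - r) n with h' | h'
  · subst h'
    have e1 : m - r - r ≠ m := by omega
    have e2 : m - r - r ≠ m - r := by omega
    have e3 : m ≠ m - r := by omega
    split_ifs <;>
      simp_all [lowerOp_single, raiseOp_single, -Finsupp.single_mul,
        Equiv.swap_apply_of_ne_of_ne e1.symm e3, Equiv.swap_apply_of_ne_of_ne e2 e1]
  have e1 : m - r ≠ n - r := by omega
  by_cases h1 : s (m - r) = false ∧ s m = true <;>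
  by_cases h2 : s (n - r) = true ∧ s n = false <;>
  simp only [h1, h2, if_true, if_false, and_self, map_zero, lowerOp_single, raiseOp_single,
    Function.comp, Equiv.swap_apply_of_ne_of_ne e1.symm h.symm,
    Equiv.swap_apply_of_ne_of_ne h'.symm hmn.symm, Equiv.swap_apply_of_ne_of_ne e1 h',
    Equiv.swap_apply_of_ne_of_ne h hmn]
  rw [comp_swap_comm s e1 h' h hmn]
  congr 1
  rw [mul_assoc, mul_assoc, ← pow_add, ← pow_add]
  congr 2
  by_cases h3 : n - r < m ∧ m < n
  · have k1 := hgtAt_swap_of_mem r s n m (m - r) (by simp; omega) (by simp; omega)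
    have k2 := hgtAt_swap_of_mem r s m (n - r) n (by simp; omega) (by simp; omega)
    rw [Equiv.swap_comm] at k1
    simp only [bits, h1, h2, Bool.toNat_true, Bool.toNat_false] at k1 k2 ⊢
    omega
  by_cases h4 : m - r < n ∧ n < m
  · have k1 := hgtAt_swap_of_mem r s m n (n - r) (by simp; omega) (by simp; omega)
    have k2 := hgtAt_swap_of_mem r s n (m - r) m (by simp; omega) (by simp; omega)
    rw [Equiv.swap_comm] at k1
    simp only [bits, h1, h2, Bool.toNat_true, Bool.toNat_false] at k1 k2 ⊢
    omega
  · have k1 := hgtAt_swap_of_notMem r s n (m - r) m (by simp; omega) (by simp; omega)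
    have k2 := hgtAt_swap_of_notMem r s m (n - r) n (by simp; omega) (by simp; omega)
    rw [k1, k2, add_comm]

lemma prodCoeff_zero_right (M : ℕ) : prodCoeff M 0 = 1 := by cases M <;> rfl

lemma prodCoeff_eq_zero {M c : ℕ} (h : M < c) : prodCoeff M c = 0 := by
  induction M generalizing c with
  | zero => obtain ⟨c, rfl⟩ : ∃ d, c = d + 1 := ⟨c - 1, by omega⟩; rfl
  | succ M ih =>
    obtain ⟨c, rfl⟩ : ∃ d, c = d + 1 := ⟨c - 1, by omega⟩
    rw [prodCoeff, ih (by omega), ih (by omega)]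
    simp

lemma windowSum_le (r : ℕ) (s : ℤ → Bool) (j : ℤ) : windowSum r s j ≤ r := by
  refine (Finset.sum_le_card_nsmul _ _ 1 fun k _ => ?_).trans (by simp)
  exact Bool.toNat_le _

lemma windowOp_eq_zero (r : ℕ) (j : ℤ) {c : ℕ} (h : r < c) : windowOp r j c = 0 := by
  refine Finsupp.lhom_ext fun s p => ?_
  rw [windowOp_single, prodCoeff_eq_zero ((windowSum_le r s j).trans_lt h)]
  simp

lemma windowOp_zero (r : ℕ) (j : ℤ) : windowOp r j 0 = 1 := by
  refine Finsupp.lhom_ext fun s p => ?_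
  rw [windowOp_single, prodCoeff_zero_right]
  simp

lemma windowOp_mul_raiseOp (r : ℕ) (hr : 1 ≤ r) (j : ℤ) (c : ℕ) :
    windowOp r j c * raiseOp r j = raiseOp r j * windowOp r (j - 1) c := by
  refine Finsupp.lhom_ext fun s p => ?_
  rw [Module.End.mul_apply, Module.End.mul_apply, windowOp_single, raiseOp_single, raiseOp_single]
  by_cases h : s (j - r) = true ∧ s j = false
  · rw [if_pos h, if_pos h, windowOp_single, windowSum_eq r hr, windowSum_pred_eq r hr,
      hgtAt_swap_self]
    simp only [bits, Function.comp, Equiv.swap_apply_right, h.1]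
    rw [mul_right_comm]
  · rw [if_neg h, if_neg h, map_zero]

lemma windowOp_mul_lowerOp (r : ℕ) (hr : 1 ≤ r) (j : ℤ) (c : ℕ) :
    windowOp r j c * lowerOp r j = lowerOp r j * windowOp r (j - 1) c := by
  refine Finsupp.lhom_ext fun s p => ?_
  rw [Module.End.mul_apply, Module.End.mul_apply, windowOp_single, lowerOp_single, lowerOp_single]
  by_cases h : s (j - r) = false ∧ s j = true
  · rw [if_pos h, if_pos h, windowOp_single, windowSum_eq r hr, windowSum_pred_eq r hr,
      hgtAt_swap_self]
    simp only [bits, Function.comp, Equiv.swap_apply_right, h.1]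
    rw [mul_right_comm]
  · rw [if_neg h, if_neg h, map_zero]

lemma windowOp_succ (r : ℕ) (hr : 1 ≤ r) (j : ℤ) (c : ℕ) :
    windowOp r j (c + 1) + windowOp r j c * (lowerOp r j * raiseOp r j) =
      windowOp r (j - 1) (c + 1) + raiseOp r j * lowerOp r j * windowOp r (j - 1) c := by
  refine Finsupp.lhom_ext fun s p => ?_
  have hp := windowSum_pred_eq r hr s j
  simp only [LinearMap.add_apply, Module.End.mul_apply, windowOp_single, lowerOp_single,
    raiseOp_single, hp]
  have hinv : (s ∘ Equiv.swap (j - (r : ℤ)) j) ∘ Equiv.swap (j - (r : ℤ)) j = s := by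
    funext i; simp
  cases h1 : s (j - r) <;> cases h2 : s j <;>
    simp only [bits, h1, h2, lowerOp_single, raiseOp_single, windowOp_single, windowSum_eq r hr s j,
      hgtAt_swap_self, Function.comp_apply, Equiv.swap_apply_left, Equiv.swap_apply_right,
      reduceCtorEq, and_self, and_false, false_and, if_true, if_false, map_zero, hinv,
      ← Finsupp.single_add, Bool.toNat_true, Bool.toNat_false, add_zero, prodCoeff]
  all_goals
    congr 1
    ring

lemma commute_scan {A : Type*} [Semiring A] {g : ℤ → A} {x : A} {l : ℤ} {n : ℕ}
    (h : ∀ i, l < i → i ≤ l + n → Commute x (g i)) (a : ℤ) : Commute x (scan g l n a) := by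
  induction n generalizing a with
  | zero => rw [scan]; split_ifs <;> simp
  | succ n ih =>
    have h' : ∀ a, Commute x (scan g l n a) := ih fun i h1 h2 => h i h1 (by push_cast; omega)
    exact (h' a).add_right ((h _ (by omega) (by push_cast; omega)).mul_right (h' _))

lemma sum_windowOp_mul (r : ℕ) (hr : 1 ≤ r) (j : ℤ) (F : ℕ → Module.End (Polynomial ℕ) Fock) :
    ∑ c ∈ Finset.range (r + 2), (windowOp r j c * F c +
        windowOp r j c * (lowerOp r j * raiseOp r j) * F (c + 1)) =
      ∑ c ∈ Finset.range (r + 2), (windowOp r (j - 1) c * F c +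
        raiseOp r j * lowerOp r j * windowOp r (j - 1) c * F (c + 1)) := by
  simp only [Finset.sum_add_distrib]
  rw [Finset.sum_range_succ', Finset.sum_range_succ (fun c => windowOp r j c * _ * F (c + 1)),
    Finset.sum_range_succ' (fun c => windowOp r (j - 1) c * F c),
    Finset.sum_range_succ (fun c => _ * windowOp r (j - 1) c * F (c + 1)),
    windowOp_eq_zero r j (Nat.lt_succ_self r), windowOp_eq_zero r (j - 1) (Nat.lt_succ_self r),
    windowOp_zero, windowOp_zero]
  simp only [zero_mul, mul_zero, add_zero]
  rw [add_right_comm, add_right_comm _ (1 * F 0), ← Finset.sum_add_distrib,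
    ← Finset.sum_add_distrib]
  simp only [← add_mul, windowOp_succ r hr]

/-- The commutation relation between the operators adding horizontal and removing vertical ribbon
strips, in a finite range of positions. -/
lemma windowOp_scan_comm (r : ℕ) (hr : 1 ≤ r) (l : ℤ) (n : ℕ) (a b : ℤ) :
    ∑ c ∈ Finset.range (r + 2), windowOp r (l + n) c *
        (scan (lowerOp r) l n (b - c) * scan (raiseOp r) l n (a - c)) =
      ∑ c ∈ Finset.range (r + 2), scan (raiseOp r) l n (a - c) *
        scan (lowerOp r) l n (b - c) * windowOp r l c := by
  induction n generalizing a b with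
  | zero =>
    refine Finset.sum_congr rfl fun c _ => ?_
    simp only [scan, Nat.cast_zero, add_zero]
    split_ifs <;> simp
  | succ n ih =>
    have hj : l + (n + 1 : ℕ) = l + n + 1 := by push_cast; ring
    have hj' : l + (n : ℤ) + 1 - 1 = l + n := by ring
    rw [hj]
    set j : ℤ := l + n + 1 with hjdef
    set U := scan (raiseOp r) l n with hU
    set D := scan (lowerOp r) l n with hD
    have hDe : ∀ b, Commute (raiseOp r j) (D b) := commute_scan fun i h1 h2 =>
      raiseOp_lowerOp_comm r hr (by omega)
    have hUf : ∀ a, Commute (lowerOp r j) (U a) := commute_scan fun i h1 h2 =>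
      (raiseOp_lowerOp_comm r hr (by omega)).symm
    have hU1 : ∀ a, scan (raiseOp r) l (n + 1) a = U a + raiseOp r j * U (a - 1) := fun _ => rfl
    have hD1 : ∀ b, scan (lowerOp r) l (n + 1) b = D b + lowerOp r j * D (b - 1) := fun _ => rfl
    have hX : ∀ a b, scan (lowerOp r) l (n + 1) b * scan (raiseOp r) l (n + 1) a =
        D b * U a + raiseOp r j * (D b * U (a - 1)) + lowerOp r j * (D (b - 1) * U a) +
          lowerOp r j * raiseOp r j * (D (b - 1) * U (a - 1)) := by
      intro a b
      rw [hU1, hD1, add_mul, mul_add, mul_add, ← mul_assoc (D b), ← (hDe b).eq,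
        mul_assoc _ (D (b - 1)) (_ * _), ← mul_assoc (D (b - 1)), ← (hDe (b - 1)).eq]
      simp only [mul_assoc]
      abel
    have hY : ∀ a b, scan (raiseOp r) l (n + 1) a * scan (lowerOp r) l (n + 1) b =
        U a * D b + raiseOp r j * (U (a - 1) * D b) + lowerOp r j * (U a * D (b - 1)) +
          raiseOp r j * lowerOp r j * (U (a - 1) * D (b - 1)) := by
      intro a b
      rw [hU1, hD1, add_mul, mul_add, mul_add, ← mul_assoc (U a), ← (hUf a).eq,
        mul_assoc _ (U (a - 1)) (_ * _), ← mul_assoc (U (a - 1)), ← (hUf (a - 1)).eq]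
      simp only [mul_assoc]
      abel
    have h1 := sum_windowOp_mul r hr j fun c => D (b - c) * U (a - c)
    simp only [Nat.cast_succ, ← sub_sub, Finset.sum_add_distrib, hj'] at h1
    have ih' : ∀ a b x, ∑ c ∈ Finset.range (r + 2), x * (windowOp r (l + n) c *
        (D (b - c) * U (a - c))) = ∑ c ∈ Finset.range (r + 2),
          x * (U (a - c) * D (b - c) * windowOp r l c) := by
      intro a b x
      rw [← Finset.mul_sum, ← Finset.mul_sum, ih]
    have e1 : ∀ (a : ℤ) (c : ℕ), a - c - 1 = a - 1 - c := fun a c => by ring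
    simp only [hX, hY, mul_add, add_mul, Finset.sum_add_distrib]
    simp only [← mul_assoc (windowOp r j _) (raiseOp r j), windowOp_mul_raiseOp r hr, hj',
      ← mul_assoc (windowOp r j _) (lowerOp r j), windowOp_mul_lowerOp r hr]
    simp only [mul_assoc] at h1 ih' ih ⊢
    simp only [windowOp_mul_lowerOp r hr, ← mul_assoc (windowOp r j _) (lowerOp r j), hj'] at h1 ⊢
    simp only [mul_assoc, e1] at h1 ⊢
    have i4 := ih' (a - 1) (b - 1) (raiseOp r j * lowerOp r j)
    simp only [mul_assoc] at i4
    rw [← ih a b, ← ih' (a - 1) b, ← ih' a (b - 1), ← i4]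
    have key : ∀ p q s t m m' : Module.End (Polynomial ℕ) Fock, p + s = q + t →
        p + m + m' + s = q + m + m' + t := by
      intro p q s t m m' h
      calc p + m + m' + s = (p + s) + (m + m') := by abel
        _ = q + m + m' + t := by rw [h]; abel
    exact key _ _ _ _ _ _ h1

/-- The bit sequence `s` is `1` to the left of `-B` and `0` from `B` on. -/
def BoundedBy (B : ℤ) (s : ℤ → Bool) : Prop := (∀ k < -B, s k = true) ∧ ∀ k ≥ B, s k = false

/-- The combinations of bit sequences bounded by `B`. -/
noncomputable def boundedPart (B : ℤ) : Submodule (Polynomial ℕ) Fock :=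
  Finsupp.supported (Polynomial ℕ) (Polynomial ℕ) {s | BoundedBy B s}

lemma BoundedBy.mono {B B' : ℤ} {s : ℤ → Bool} (h : BoundedBy B s) (hB : B ≤ B') :
    BoundedBy B' s :=
  ⟨fun k hk => h.1 k (by omega), fun k hk => h.2 k (by omega)⟩

lemma boundedPart_mono {B B' : ℤ} (hB : B ≤ B') : boundedPart B ≤ boundedPart B' :=
  Finsupp.supported_mono fun _ hs => BoundedBy.mono hs hB

lemma single_mem_boundedPart {B : ℤ} {s : ℤ → Bool} (h : BoundedBy B s) (p : Polynomial ℕ) :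
    Finsupp.single s p ∈ boundedPart B :=
  Finsupp.single_mem_supported _ _ h

lemma mem_of_mem_boundedPart {B : ℤ} {v : Fock} (hv : v ∈ boundedPart B)
    {N : Submodule (Polynomial ℕ) Fock} (h : ∀ s, BoundedBy B s → Finsupp.single s 1 ∈ N) :
    v ∈ N := by
  have hN : boundedPart B ≤ N := by
    rw [boundedPart, Finsupp.supported_eq_span_single, Submodule.span_le]
    rintro _ ⟨s, hs, rfl⟩
    exact h s hs
  exact hN hv

lemma raiseOp_mem_boundedPart (r : ℕ) (j : ℤ) {B : ℤ} {v : Fock} (hv : v ∈ boundedPart B) :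
    raiseOp r j v ∈ boundedPart (B + r) := by
  refine mem_of_mem_boundedPart hv (N := (boundedPart (B + r)).comap (raiseOp r j)) fun s hs => ?_
  rw [Submodule.mem_comap, raiseOp_single]
  split_ifs with h
  · have h1 : j - r < B := by by_contra hc; simp [hs.2 _ (not_lt.mp hc)] at h
    have h2 : -B ≤ j := by by_contra hc; simp [hs.1 _ (not_le.mp hc)] at h
    refine single_mem_boundedPart ⟨fun k hk => ?_, fun k hk => ?_⟩ _
    · rw [Function.comp, Equiv.swap_apply_of_ne_of_ne (by omega) (by omega)]
      exact hs.1 k (by omega)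
    · rw [Function.comp, Equiv.swap_apply_of_ne_of_ne (by omega) (by omega)]
      exact hs.2 k (by omega)
  · exact zero_mem _

lemma lowerOp_mem_boundedPart (r : ℕ) (j : ℤ) {B : ℤ} {v : Fock} (hv : v ∈ boundedPart B) :
    lowerOp r j v ∈ boundedPart B := by
  refine mem_of_mem_boundedPart hv (N := (boundedPart B).comap (lowerOp r j)) fun s hs => ?_
  rw [Submodule.mem_comap, lowerOp_single]
  split_ifs with h
  · have h1 : j < B := by by_contra hc; simp [hs.2 _ (not_lt.mp hc)] at h
    have h2 : -B ≤ j - r := by by_contra hc; simp [hs.1 _ (not_le.mp hc)] at h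
    refine single_mem_boundedPart ⟨fun k hk => ?_, fun k hk => ?_⟩ _
    · rw [Function.comp, Equiv.swap_apply_of_ne_of_ne (by omega) (by omega)]
      exact hs.1 k (by omega)
    · rw [Function.comp, Equiv.swap_apply_of_ne_of_ne (by omega) (by omega)]
      exact hs.2 k (by omega)
  · exact zero_mem _

lemma scan_raiseOp_mem_boundedPart (r : ℕ) (l : ℤ) (n : ℕ) (a : ℤ) {B : ℤ} {v : Fock}
    (hv : v ∈ boundedPart B) : scan (raiseOp r) l n a v ∈ boundedPart (B + r * a) := by
  induction n generalizing a with
  | zero =>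
    rw [scan]
    split_ifs with h
    · subst h; simpa using hv
    · exact zero_mem _
  | succ n ih =>
    refine add_mem (ih a) ?_
    have := raiseOp_mem_boundedPart r (l + n + 1) (ih (a - 1))
    rwa [show B + r * (a - 1) + r = B + r * a by ring] at this

lemma scan_lowerOp_mem_boundedPart (r : ℕ) (l : ℤ) (n : ℕ) (a : ℤ) {B : ℤ} {v : Fock}
    (hv : v ∈ boundedPart B) : scan (lowerOp r) l n a v ∈ boundedPart B := by
  induction n generalizing a with
  | zero =>
    rw [scan]
    split_ifs with h
    · exact hv
    · exact zero_mem _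
  | succ n ih =>
    have := lowerOp_mem_boundedPart r (l + n + 1) (ih (a - 1))
    exact add_mem (ih a) this

lemma windowOp_apply_right (r : ℕ) (j : ℤ) (c : ℕ) {B : ℤ} (hB : B + r ≤ j + 1) {v : Fock}
    (hv : v ∈ boundedPart B) : windowOp r j c v = if c = 0 then v else 0 := by
  split_ifs with hc
  · rw [hc, windowOp_zero]; rfl
  refine mem_of_mem_boundedPart hv (N := LinearMap.ker (windowOp r j c)) fun s hs => ?_
  have : windowSum r s j = 0 := by
    refine Finset.sum_eq_zero fun k hk => ?_
    rw [bits, hs.2 _ (by have := Finset.mem_range.mp hk; omega)]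
    rfl
  rw [LinearMap.mem_ker, windowOp_single, this, prodCoeff_eq_zero (by omega)]
  simp

lemma windowOp_apply_left (r : ℕ) (j : ℤ) (c : ℕ) {B : ℤ} (hB : j < -B) {v : Fock}
    (hv : v ∈ boundedPart B) : windowOp r j c v = prodCoeff r c • v := by
  refine mem_of_mem_boundedPart hv (N := LinearMap.eqLocus (windowOp r j c)
    (prodCoeff r c • LinearMap.id)) fun s hs => ?_
  have : windowSum r s j = r := by
    rw [windowSum, Finset.sum_congr rfl fun k (_ : k ∈ Finset.range r) =>
      show bits s (j - k) = 1 by rw [bits, hs.1 _ (by omega)]; rfl]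
    simp
  rw [LinearMap.mem_eqLocus, windowOp_single, this]
  simp

lemma scan_lowerOp_scan_raiseOp (r : ℕ) (hr : 1 ≤ r) (l : ℤ) (n : ℕ) (a b : ℤ) {B : ℤ}
    (hl : l < -B) (hn : B + r * a + r ≤ l + n + 1) {v : Fock} (hv : v ∈ boundedPart B) :
    scan (lowerOp r) l n b (scan (raiseOp r) l n a v) = ∑ c ∈ Finset.range (r + 2),
      prodCoeff r c • scan (raiseOp r) l n (a - c) (scan (lowerOp r) l n (b - c) v) := by
  have h := LinearMap.congr_fun (windowOp_scan_comm r hr l n a b) v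
  simp only [LinearMap.sum_apply, Module.End.mul_apply] at h
  have h2 : ∀ c, windowOp r l c v = prodCoeff r c • v := fun c => windowOp_apply_left r l c hl hv
  simp only [h2, map_smul] at h
  rw [← h, Finset.sum_eq_single 0]
  · rw [windowOp_zero]; simp
  · intro c _ hc
    rw [windowOp_apply_right r (l + n) c (B := B + r * (a - c)) ?_
      (scan_lowerOp_mem_boundedPart _ _ _ _ (scan_raiseOp_mem_boundedPart _ _ _ _ hv)), if_neg hc]
    nlinarith [mul_nonneg (Int.natCast_nonneg r) (Int.natCast_nonneg c)]
  · simp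

lemma sum_powerset_union {ι M : Type*} [DecidableEq ι] [AddCommMonoid M] {s t : Finset ι}
    (h : Disjoint s t) (f : Finset ι → M) :
    ∑ T ∈ (s ∪ t).powerset, f T = ∑ S ∈ s.powerset, ∑ T ∈ t.powerset, f (S ∪ T) := by
  induction t using Finset.induction_on generalizing f with
  | empty => simp
  | insert x t hx ih =>
    rw [Finset.disjoint_insert_right] at h
    rw [Finset.union_insert, Finset.sum_powerset_insert (by simp [h.1, hx]), ih h.2, ih h.2,
      ← Finset.sum_add_distrib]
    refine Finset.sum_congr rfl fun S _ => ?_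
    rw [Finset.sum_powerset_insert hx]
    simp only [Finset.union_insert]

/-- The weight `X ^ (2 Σ h)` of a set of triples `(i, j, h)`. -/
noncomputable def tripleWt (T : Finset (ℕ × ℕ × ℕ)) : Polynomial ℕ :=
  Polynomial.X ^ (2 * ∑ x ∈ T, x.2.2)

lemma tripleWt_union {S T : Finset (ℕ × ℕ × ℕ)} (h : Disjoint S T) :
    tripleWt (S ∪ T) = tripleWt S * tripleWt T := by
  rw [tripleWt, Finset.sum_union h, mul_add, pow_add]; rfl

lemma sum_prodCoeff_smul (i j M : ℕ) (H : ℕ → Fock) :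
    ∑ c ∈ Finset.range (M + 2), prodCoeff M c • H c =
      ∑ T ∈ ({i} ×ˢ {j} ×ˢ Finset.range M : Finset (ℕ × ℕ × ℕ)).powerset,
        tripleWt T • H T.card := by
  induction M generalizing H with
  | zero => simp [Finset.sum_range_succ, prodCoeff, tripleWt]
  | succ M ih =>
    have hx : (i, j, M) ∉ ({i} ×ˢ {j} ×ˢ Finset.range M : Finset (ℕ × ℕ × ℕ)) := by simp
    have hi : ({i} ×ˢ {j} ×ˢ Finset.range (M + 1) : Finset (ℕ × ℕ × ℕ)) =
        insert (i, j, M) ({i} ×ˢ {j} ×ˢ Finset.range M) := by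
      ext ⟨a, b, c⟩
      simp only [Finset.mem_product, Finset.mem_singleton, Finset.mem_range, Finset.mem_insert,
        Prod.mk.injEq]
      omega
    have h1 : ∑ T ∈ ({i} ×ˢ {j} ×ˢ Finset.range M : Finset (ℕ × ℕ × ℕ)).powerset,
        tripleWt (insert (i, j, M) T) • H (insert (i, j, M) T).card =
        ∑ T ∈ ({i} ×ˢ {j} ×ˢ Finset.range M : Finset (ℕ × ℕ × ℕ)).powerset,
          tripleWt T • ((Polynomial.X : Polynomial ℕ) ^ (2 * M) • H (T.card + 1)) := by
      refine Finset.sum_congr rfl fun T hT => ?_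
      have hxT : (i, j, M) ∉ T := fun h => hx (Finset.mem_powerset.mp hT h)
      rw [Finset.card_insert_of_notMem hxT, smul_smul, tripleWt, Finset.sum_insert hxT, mul_add,
        pow_add, mul_comm]
      rfl
    rw [hi, Finset.sum_powerset_insert hx, h1, ← ih, ← ih fun c => _ • H (c + 1),
      Finset.sum_range_succ', Finset.sum_range_succ' (fun c => prodCoeff M c • H c),
      prodCoeff_zero_right, prodCoeff_zero_right, add_right_comm]
    congr 1
    rw [← zero_add (∑ k ∈ Finset.range (M + 1), _), ← zero_smul (Polynomial ℕ) (H (M + 1 + 1)),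
      ← prodCoeff_eq_zero (show M < M + 1 + 1 by omega), add_comm (_ • _),
      ← Finset.sum_range_succ (fun k => prodCoeff M (k + 1) • H (k + 1)), ← Finset.sum_add_distrib]
    refine Finset.sum_congr rfl fun c _ => ?_
    rw [prodCoeff, add_smul, smul_smul, mul_comm]

/-- The number of elements of `T` in column `j`. -/
def colCount (T : Finset (ℕ × ℕ × ℕ)) (j : ℕ) : ℕ := (T.filter fun x => x.2.1 = j).card

/-- The number of elements of `T` in row `i`. -/
def rowCount (T : Finset (ℕ × ℕ × ℕ)) (i : ℕ) : ℕ := (T.filter fun x => x.1 = i).card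

/-- Successive application to `v` of the operators `U (α 0), …, U (α (n - 1))`. -/
noncomputable def iterApply {ι : Type*} (U : ι → Module.End (Polynomial ℕ) Fock) (α : ℕ → ι)
    (v : Fock) : ℕ → Fock
  | 0 => v
  | n + 1 => U (α n) (iterApply U α v n)

lemma iterApply_congr {ι ι' : Type*} {U : ι → Module.End (Polynomial ℕ) Fock}
    {U' : ι' → Module.End (Polynomial ℕ) Fock} {α : ℕ → ι} {α' : ℕ → ι'} (v : Fock) {n : ℕ}
    (h : ∀ j < n, U (α j) = U' (α' j)) : iterApply U α v n = iterApply U' α' v n := by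
  induction n with
  | zero => rfl
  | succ n ih => rw [iterApply, iterApply, h n (by omega), ih fun j hj => h j (by omega)]

lemma iterApply_scan_mem_boundedPart (r : ℕ) (l : ℤ) (N : ℕ) {α : ℕ → ℤ} {K B : ℤ}
    (hα : ∀ j, α j ≤ K) {v : Fock} (hv : v ∈ boundedPart B) (n : ℕ) :
    iterApply (scan (raiseOp r) l N) α v n ∈ boundedPart (B + r * K * n) := by
  induction n with
  | zero => simpa [iterApply] using hv
  | succ n ih =>
    refine boundedPart_mono ?_ (scan_raiseOp_mem_boundedPart r l N (α n) ih)
    push_cast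
    nlinarith [mul_le_mul_of_nonneg_left (hα n) (Int.natCast_nonneg r)]

lemma scan_lowerOp_core (r : ℕ) (l : ℤ) (N : ℕ) {γ : ℤ → Bool}
    (hγ : ∀ k, ¬(γ (k - r) = false ∧ γ k = true)) (b : ℤ) (p : Polynomial ℕ) :
    scan (lowerOp r) l N b (Finsupp.single γ p) = if b = 0 then Finsupp.single γ p else 0 := by
  induction N generalizing b with
  | zero => rw [scan]; split_ifs <;> rfl
  | succ N ih =>
    rw [scan, LinearMap.add_apply, Module.End.mul_apply, ih, ih]
    split_ifs <;> simp [lowerOp_single, hγ]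

lemma scan_lowerOp_iterApply (r : ℕ) (hr : 1 ≤ r) (l : ℤ) (N : ℕ) {γ : ℤ → Bool}
    (hγ : ∀ k, ¬(γ (k - r) = false ∧ γ k = true)) {α : ℕ → ℤ} {K B : ℤ} (hK : 0 ≤ K)
    (hα : ∀ j, α j ≤ K) (hB : BoundedBy B γ) (i n : ℕ) (hl : l < -(B + r * K * n))
    (hN : B + r * K * n + r ≤ l + N + 1) (b : ℤ) :
    scan (lowerOp r) l N b (iterApply (scan (raiseOp r) l N) α (Finsupp.single γ 1) n) =
      ∑ T ∈ ({i} ×ˢ Finset.range n ×ˢ Finset.range r : Finset (ℕ × ℕ × ℕ)).powerset,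
        tripleWt T • if (T.card : ℤ) = b then iterApply (scan (raiseOp r) l N)
          (fun j => α j - colCount T j) (Finsupp.single γ 1) n else 0 := by
  induction n generalizing b with
  | zero => simp [iterApply, scan_lowerOp_core r l N hγ, tripleWt, eq_comm]
  | succ n ih =>
    have hrK : (0 : ℤ) ≤ r * K := by positivity
    push_cast at hl hN
    have hdisj : Disjoint ({i} ×ˢ {n} ×ˢ Finset.range r : Finset (ℕ × ℕ × ℕ))
        ({i} ×ˢ Finset.range n ×ˢ Finset.range r) := by
      rw [Finset.disjoint_left]
      rintro ⟨a, b, c⟩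
      simp only [Finset.mem_product, Finset.mem_singleton, Finset.mem_range]
      omega
    have hunion : ({i} ×ˢ Finset.range (n + 1) ×ˢ Finset.range r : Finset (ℕ × ℕ × ℕ)) =
        {i} ×ˢ {n} ×ˢ Finset.range r ∪ {i} ×ˢ Finset.range n ×ˢ Finset.range r := by
      ext ⟨a, b, c⟩
      simp only [Finset.mem_product, Finset.mem_singleton, Finset.mem_range, Finset.mem_union]
      omega
    rw [iterApply, scan_lowerOp_scan_raiseOp r hr l N (α n) b (B := B + r * K * n) (by nlinarith)
      (by nlinarith [mul_le_mul_of_nonneg_left (hα n) (Int.natCast_nonneg r)])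
      (iterApply_scan_mem_boundedPart r l N hα (single_mem_boundedPart hB 1) n),
      sum_prodCoeff_smul i n r fun c => scan (raiseOp r) l N (α n - c) (scan (lowerOp r) l N (b - c)
        (iterApply (scan (raiseOp r) l N) α (Finsupp.single γ 1) n)),
      hunion, sum_powerset_union hdisj]
    refine Finset.sum_congr rfl fun S hS => ?_
    rw [ih (by nlinarith) (by nlinarith), map_sum, Finset.smul_sum]
    refine Finset.sum_congr rfl fun T hT => ?_
    rw [Finset.mem_powerset] at hS hT
    have hST : Disjoint S T := Finset.disjoint_of_subset_left hS
      (Finset.disjoint_of_subset_right hT hdisj)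
    have hcolS : ∀ x ∈ S, x.2.1 = n := fun x hx => by
      have := hS hx
      simp only [Finset.mem_product, Finset.mem_singleton] at this
      exact this.2.1
    have hcolT : ∀ x ∈ T, x.2.1 < n := fun x hx => by
      have := hT hx
      simp only [Finset.mem_product, Finset.mem_range] at this
      exact this.2.1
    have hn : colCount (S ∪ T) n = S.card := by
      rw [colCount, Finset.filter_union, Finset.filter_true_of_mem hcolS,
        Finset.filter_false_of_mem fun x hx => (hcolT x hx).ne, Finset.union_empty]
    have hlt : ∀ j < n, colCount (S ∪ T) j = colCount T j := by
      intro j hj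
      rw [colCount, Finset.filter_union, Finset.filter_false_of_mem (s := S) fun x hx => by
        rw [hcolS x hx]; omega, Finset.empty_union, colCount]
    rw [map_smul, smul_smul, tripleWt_union hST, Finset.card_union_of_disjoint hST, iterApply, hn]
    congr 1
    have hiff : (T.card : ℤ) = b - S.card ↔ ((S.card + T.card : ℕ) : ℤ) = b := by
      push_cast; omega
    simp only [hiff]
    split_ifs
    · congr 1
      exact iterApply_congr _ fun j hj => by rw [hlt j hj]
    · exact map_zero _

lemma raiseOp_apply_core (r : ℕ) (j : ℤ) {γ : ℤ → Bool}
    (hγ : ∀ k, ¬(γ (k - r) = false ∧ γ k = true)) (v : Fock) : raiseOp r j v γ = 0 := by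
  induction v using Finsupp.induction_linear with
  | zero => simp
  | add v w hv hw => rw [map_add, Finsupp.add_apply, hv, hw, add_zero]
  | single s p =>
    rw [raiseOp_single]
    split_ifs with h
    · rw [Finsupp.single_apply, if_neg]
      rintro rfl
      exact hγ j (by simp [h])
    · rfl

lemma iterApply_scan_raiseOp_core (r : ℕ) (l : ℤ) (N : ℕ) {γ : ℤ → Bool}
    (hγ : ∀ k, ¬(γ (k - r) = false ∧ γ k = true)) (α : ℕ → ℤ) (n : ℕ) :
    iterApply (scan (raiseOp r) l N) α (Finsupp.single γ 1) n γ =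
      if ∀ j < n, α j = 0 then 1 else 0 := by
  have key : ∀ N a v, scan (raiseOp r) l N a v γ = if a = 0 then v γ else 0 := by
    intro N
    induction N with
    | zero => intro a v; rw [scan]; split_ifs <;> rfl
    | succ N ih =>
      intro a v
      rw [scan, LinearMap.add_apply, Module.End.mul_apply, Finsupp.add_apply, ih,
        raiseOp_apply_core r _ hγ, add_zero]
  induction n with
  | zero => simp [iterApply]
  | succ n ih =>
    rw [iterApply, key, ih]
    simp only [Nat.forall_lt_succ_right]
    split_ifs <;> simp_all

/-- The operator applying the operators of degrees `β (m - 1), …, β 0`, in this order. -/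
noncomputable def revApply (D : ℤ → Module.End (Polynomial ℕ) Fock) (β : ℕ → ℤ) :
    ℕ → Module.End (Polynomial ℕ) Fock
  | 0 => 1
  | m + 1 => revApply D β m * D (β m)

lemma colCount_union {S T : Finset (ℕ × ℕ × ℕ)} (h : Disjoint S T) (j : ℕ) :
    colCount (S ∪ T) j = colCount S j + colCount T j := by
  rw [colCount, Finset.filter_union,
    Finset.card_union_of_disjoint (Finset.disjoint_filter_filter h)]
  rfl

lemma rowCount_union {S T : Finset (ℕ × ℕ × ℕ)} (h : Disjoint S T) (i : ℕ) :
    rowCount (S ∪ T) i = rowCount S i + rowCount T i := by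
  rw [rowCount, Finset.filter_union,
    Finset.card_union_of_disjoint (Finset.disjoint_filter_filter h)]
  rfl

theorem revApply_iterApply_core (r : ℕ) (hr : 1 ≤ r) (l : ℤ) (N : ℕ) {γ : ℤ → Bool}
    (hγ : ∀ k, ¬(γ (k - r) = false ∧ γ k = true)) (β : ℕ → ℤ) {α : ℕ → ℤ} {K B : ℤ} (hK : 0 ≤ K)
    (hα : ∀ j, α j ≤ K) (hB : BoundedBy B γ) (m n : ℕ) (hl : l < -(B + r * K * n))
    (hN : B + r * K * n + r ≤ l + N + 1) :
    revApply (scan (lowerOp r) l N) β m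
        (iterApply (scan (raiseOp r) l N) α (Finsupp.single γ 1) n) γ =
      ∑ T ∈ (Finset.range m ×ˢ Finset.range n ×ˢ Finset.range r : Finset (ℕ × ℕ × ℕ)).powerset,
        if (∀ i < m, (rowCount T i : ℤ) = β i) ∧ ∀ j < n, (colCount T j : ℤ) = α j
          then tripleWt T else 0 := by
  induction m generalizing α with
  | zero =>
    have : ∀ j, (0 : ℤ) = α j ↔ α j = 0 := fun j => eq_comm
    simp [revApply, iterApply_scan_raiseOp_core r l N hγ, colCount, tripleWt, this]
  | succ m ih =>
    have hdisj : Disjoint ({m} ×ˢ Finset.range n ×ˢ Finset.range r : Finset (ℕ × ℕ × ℕ))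
        (Finset.range m ×ˢ Finset.range n ×ˢ Finset.range r) := by
      rw [Finset.disjoint_left]
      rintro ⟨a, b, c⟩
      simp only [Finset.mem_product, Finset.mem_singleton, Finset.mem_range]
      omega
    have hunion : (Finset.range (m + 1) ×ˢ Finset.range n ×ˢ Finset.range r :
        Finset (ℕ × ℕ × ℕ)) = {m} ×ˢ Finset.range n ×ˢ Finset.range r ∪
          Finset.range m ×ˢ Finset.range n ×ˢ Finset.range r := by
      ext ⟨a, b, c⟩
      simp only [Finset.mem_product, Finset.mem_singleton, Finset.mem_range, Finset.mem_union]
      omega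
    rw [revApply, Module.End.mul_apply, scan_lowerOp_iterApply r hr l N hγ hK hα hB m n hl hN,
      map_sum, Finsupp.finsetSum_apply, hunion, sum_powerset_union hdisj]
    refine Finset.sum_congr rfl fun S hS => ?_
    have key : ∀ T ∈ (Finset.range m ×ˢ Finset.range n ×ˢ Finset.range r :
        Finset (ℕ × ℕ × ℕ)).powerset,
        (if (∀ i < m + 1, (rowCount (S ∪ T) i : ℤ) = β i) ∧
            ∀ j < n, (colCount (S ∪ T) j : ℤ) = α j then tripleWt (S ∪ T) else 0) =
        tripleWt S * if (S.card : ℤ) = β m then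
          if (∀ i < m, (rowCount T i : ℤ) = β i) ∧
            ∀ j < n, (colCount T j : ℤ) = α j - colCount S j then tripleWt T else 0
          else 0 := by
      intro T hT
      rw [Finset.mem_powerset] at hS hT
      have hST : Disjoint S T := Finset.disjoint_of_subset_left hS
        (Finset.disjoint_of_subset_right hT hdisj)
      have hrowS : ∀ x ∈ S, x.1 = m := fun x hx => by
        have := hS hx
        simp only [Finset.mem_product, Finset.mem_singleton] at this
        exact this.1
      have hrowT : ∀ x ∈ T, x.1 < m := fun x hx => by
        have := hT hx
        simp only [Finset.mem_product, Finset.mem_range] at this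
        exact this.1
      have hm : rowCount (S ∪ T) m = S.card := by
        rw [rowCount_union hST, rowCount, rowCount, Finset.filter_true_of_mem hrowS,
          Finset.filter_false_of_mem fun x hx => (hrowT x hx).ne, Finset.card_empty, add_zero]
      have hlt : ∀ i < m, rowCount (S ∪ T) i = rowCount T i := by
        intro i hi
        rw [rowCount_union hST, rowCount, Finset.filter_false_of_mem fun x hx => by
          rw [hrowS x hx]; omega, Finset.card_empty, zero_add]
      have hrow : (∀ i < m + 1, (rowCount (S ∪ T) i : ℤ) = β i) ↔
          (∀ i < m, (rowCount T i : ℤ) = β i) ∧ (S.card : ℤ) = β m := by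
        rw [Nat.forall_lt_succ_right, hm]
        exact and_congr_left fun _ => forall₂_congr fun i hi => by rw [hlt i hi]
      have hcol : (∀ j < n, (colCount (S ∪ T) j : ℤ) = α j) ↔
          ∀ j < n, (colCount T j : ℤ) = α j - colCount S j := by
        refine forall₂_congr fun j _ => ?_
        rw [colCount_union hST]
        push_cast
        constructor <;> intro <;> omega
      rw [tripleWt_union hST]
      simp only [hrow, hcol]
      split_ifs <;> simp_all
    rw [Finset.sum_congr rfl key, ← Finset.mul_sum, map_smul, Finsupp.smul_apply, smul_eq_mul]
    congr 1
    split_ifs with hc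
    · exact ih fun j => by have := hα j; omega
    · simp

lemma hop_apply (r : ℕ) (ω : ℕ → ℕ) (j : ℤ) (v : Fock) (t : ℤ → Bool) :
    hop r ω j v t = if t (j - r) = false ∧ t j = true then
      v (t ∘ Equiv.swap (j - r) j) * Polynomial.X ^ ω (hgtAt r (bits t) j) else 0 := by
  induction v using Finsupp.induction_linear with
  | zero => simp
  | add v w hv hw =>
    rw [map_add, Finsupp.add_apply, hv, hw, Finsupp.add_apply]
    split_ifs
    · rw [add_mul]
    · rw [add_zero]
  | single s p =>
    have hinv : s ∘ Equiv.swap (j - r) j = t ↔ s = t ∘ Equiv.swap (j - r) j := by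
      constructor
      · rintro rfl; funext i; simp
      · rintro rfl; funext i; simp
    rw [hop_single]
    by_cases hst : s = t ∘ Equiv.swap (j - r) j
    · subst hst
      simp only [Function.comp_apply, Equiv.swap_apply_left, Equiv.swap_apply_right,
        Finsupp.single_eq_same, hgtAt_swap_self]
      simp only [and_comm (a := t j = true)]
      split_ifs
      · rw [hinv.mpr rfl, Finsupp.single_eq_same]
      · rfl
    · rw [Finsupp.single_apply, if_neg hst, zero_mul, ite_self]
      split_ifs
      · rw [Finsupp.single_apply, if_neg (mt hinv.mp hst)]
      · rfl

/-- `w` is a witness for `t/s` all of whose ribbons have their heads in `(l, l + n]`. -/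
def WitnessIn (r : ℕ) (l : ℤ) (n : ℕ) (s t : ℤ → Bool) (w : ℤ → ℕ) : Prop :=
  (∀ i : ℤ, (w (i - r) = bits t (i - r) ∧ bits s i = w i) ∨ Quad r (bits s) (bits t) w i) ∧
    ∀ i, Quad r (bits s) (bits t) w i → l < i ∧ i ≤ l + n

lemma WitnessIn.finite {r : ℕ} {l : ℤ} {n : ℕ} {s t : ℤ → Bool} {w : ℤ → ℕ}
    (h : WitnessIn r l n s t w) : {i | Quad r (bits s) (bits t) w i}.Finite :=
  (Set.finite_Icc l (l + n)).subset fun i hi => ⟨(h.2 i hi).1.le, (h.2 i hi).2⟩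

lemma WitnessIn.isWitness {r : ℕ} {l : ℤ} {n : ℕ} {s t : ℤ → Bool} {w : ℤ → ℕ}
    (h : WitnessIn r l n s t w) : IsWitness r (bits s) (bits t) w := ⟨h.1, h.finite⟩

lemma WitnessIn.apply_of_lt {r : ℕ} {l : ℤ} {n : ℕ} {s t : ℤ → Bool} {w : ℤ → ℕ}
    (h : WitnessIn r l n s t w) {i : ℤ} (hi : l + n < i) :
    w (i - r) = bits t (i - r) ∧ bits s i = w i :=
  (h.1 i).resolve_right fun hq => by have := h.2 i hq; omega

lemma WitnessIn.apply_of_lt' {r : ℕ} {l : ℤ} {n : ℕ} {s t : ℤ → Bool} {w : ℤ → ℕ}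
    (h : WitnessIn r l n s t w) {i : ℤ} (hi : l + n < i + r) : w i = bits t i := by
  have := (h.apply_of_lt hi).1
  rwa [add_sub_cancel_right] at this

lemma WitnessIn.mono {r : ℕ} {l : ℤ} {n : ℕ} {s t : ℤ → Bool} {w : ℤ → ℕ}
    (h : WitnessIn r l n s t w) : WitnessIn r l (n + 1) s t w :=
  ⟨h.1, fun i hi => by have := h.2 i hi; push_cast; omega⟩

lemma bits_swap_of_ne {t : ℤ → Bool} {a b i : ℤ} (ha : i ≠ a) (hb : i ≠ b) :
    bits (t ∘ Equiv.swap a b) i = bits t i := by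
  rw [bits, bits, Function.comp, Equiv.swap_apply_of_ne_of_ne ha hb]

lemma bits_swap_left {t : ℤ → Bool} {a b : ℤ} : bits (t ∘ Equiv.swap a b) a = bits t b := by
  rw [bits, bits, Function.comp, Equiv.swap_apply_left]

lemma bits_swap_right {t : ℤ → Bool} {a b : ℤ} : bits (t ∘ Equiv.swap a b) b = bits t a := by
  rw [bits, bits, Function.comp, Equiv.swap_apply_right]

lemma WitnessIn.insert {r : ℕ} (hr : 1 ≤ r) {l : ℤ} {n : ℕ} {s t : ℤ → Bool} {w : ℤ → ℕ} {j : ℤ}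
    (hj : j = l + n + 1) (h1 : bits t (j - r) = 0) (h2 : bits t j = 1)
    (h : WitnessIn r l n s (t ∘ Equiv.swap (j - r) j) w) :
    WitnessIn r l (n + 1) s t (Function.update w j 1) := by
  have hjr : w j = bits (t ∘ Equiv.swap (j - r) j) j := h.apply_of_lt' (by omega)
  have hj' := h.apply_of_lt (i := j) (by omega)
  rw [bits_swap_right] at hjr
  rw [bits_swap_left] at hj'
  refine ⟨fun i => ?_, fun i hi => ?_⟩
  · rcases eq_or_ne i j with rfl | hij
    · right
      refine ⟨?_, h1, by omega, by simp⟩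
      rw [Function.update_of_ne (by omega)]
      omega
    rcases eq_or_ne (i - r) j with hij' | hij'
    · left
      have := h.apply_of_lt (i := i) (by omega)
      rw [hij', Function.update_self, Function.update_of_ne hij]
      exact ⟨h2.symm, this.2⟩
    · rw [Quad, Function.update_of_ne hij, Function.update_of_ne hij']
      have := h.1 i
      rwa [Quad, bits_swap_of_ne (by omega) hij'] at this
  · rcases eq_or_ne i j with rfl | hij
    · push_cast; omega
    rcases eq_or_ne (i - r) j with hij' | hij'
    · have := hi.2.1
      rw [hij'] at this
      omega
    · rw [Quad, Function.update_of_ne hij, Function.update_of_ne hij'] at hi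
      have := h.2 i (by rw [Quad, bits_swap_of_ne (by omega) hij']; exact hi)
      push_cast
      omega

lemma WitnessIn.erase {r : ℕ} (hr : 1 ≤ r) {l : ℤ} {n : ℕ} {s t : ℤ → Bool} {w : ℤ → ℕ} {j : ℤ}
    (hj : j = l + n + 1) (hq : Quad r (bits s) (bits t) w j) (h : WitnessIn r l (n + 1) s t w) :
    WitnessIn r l n s (t ∘ Equiv.swap (j - r) j) (Function.update w j 0) ∧
      ∀ i, Quad r (bits s) (bits (t ∘ Equiv.swap (j - r) j)) (Function.update w j 0) i ↔
        i ≠ j ∧ Quad r (bits s) (bits t) w i := by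
  have hjr : w j = bits t j := h.apply_of_lt' (by push_cast; omega)
  have key : ∀ i, Quad r (bits s) (bits (t ∘ Equiv.swap (j - r) j)) (Function.update w j 0) i ↔
        i ≠ j ∧ Quad r (bits s) (bits t) w i := by
    intro i
    rcases eq_or_ne i j with rfl | hij
    · simp [Quad]
    rcases eq_or_ne (i - r) j with hij' | hij'
    · rw [Quad, hij', Function.update_self]
      refine iff_of_false (by simp) fun hi => ?_
      have := h.2 i hi.2
      push_cast at this
      omega
    · rw [Quad, bits_swap_of_ne (by omega) hij', Function.update_of_ne hij,
        Function.update_of_ne hij']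
      exact ⟨fun h => ⟨hij, h⟩, fun h => h.2⟩
  refine ⟨⟨fun i => ?_, fun i hi => ?_⟩, key⟩
  · rw [key]
    rcases eq_or_ne i j with rfl | hij
    · left
      rw [bits_swap_left, Function.update_self, Function.update_of_ne (by omega)]
      exact ⟨by rw [hq.1, ← hjr, hq.2.2.2], hq.2.2.1⟩
    rcases eq_or_ne (i - r) j with hij' | hij'
    · left
      have := h.apply_of_lt (i := i) (by push_cast; omega)
      rw [hij', bits_swap_right, Function.update_self, Function.update_of_ne hij]
      exact ⟨hq.2.1.symm, this.2⟩
    · rw [bits_swap_of_ne (by omega) hij', Function.update_of_ne hij, Function.update_of_ne hij']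
      exact (h.1 i).imp_right fun h => ⟨hij, h⟩
  · rw [key] at hi
    have := h.2 i hi.2
    push_cast at this
    have := hi.1
    omega

lemma bits_injective : Function.Injective bits := fun s t h => by
  funext i
  have := congrFun h i
  simp only [bits] at this
  cases hs : s i <;> cases ht : t i <;> simp_all

lemma WitnessIn.eq_of_zero {r : ℕ} {l : ℤ} {s t : ℤ → Bool} {w : ℤ → ℕ}
    (h : WitnessIn r l 0 s t w) : s = t := by
  refine bits_injective (funext fun i => ?_)
  have hq : ∀ i, ¬ Quad r (bits s) (bits t) w i := fun i hi => by
    have := h.2 i hi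
    push_cast at this
    omega
  have h1 := ((h.1 i).resolve_right (hq _)).2
  have h2 := ((h.1 (i + r)).resolve_right (hq _)).1
  rw [add_sub_cancel_right] at h2
  rw [h1, h2]

lemma scan_hop_succ_apply (r : ℕ) (ω : ℕ → ℕ) (l : ℤ) (n : ℕ) (a : ℤ) (v : Fock)
    (t : ℤ → Bool) {j : ℤ} (hj : j = l + n + 1) :
    scan (hop r ω) l (n + 1) a v t = scan (hop r ω) l n a v t +
      if bits t (j - r) = 0 ∧ bits t j = 1 then
        scan (hop r ω) l n (a - 1) v (t ∘ Equiv.swap (j - r) j) *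
          Polynomial.X ^ ω (hgtAt r (bits t) j) else 0 := by
  have h1 : bits t (j - r) = 0 ↔ t (j - r) = false := by simp [bits]
  have h2 : bits t j = 1 ↔ t j = true := by simp [bits]
  rw [scan, LinearMap.add_apply, Module.End.mul_apply, Finsupp.add_apply, hop_apply r, ← hj]
  simp only [h1, h2]

lemma exists_witnessIn_of_scan_hop_ne_zero (r : ℕ) (hr : 1 ≤ r) (ω : ℕ → ℕ) (l : ℤ) (n : ℕ)
    (a : ℤ) {s t : ℤ → Bool} (h : scan (hop r ω) l n a (Finsupp.single s 1) t ≠ 0) :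
    ∃ w, WitnessIn r l n s t w := by
  induction n generalizing a t with
  | zero =>
    refine ⟨bits s, ?_⟩
    obtain rfl : s = t := by
      by_contra hst
      apply h
      rw [scan]
      split_ifs
      · rw [Module.End.one_apply, Finsupp.single_apply, if_neg hst]
      · rfl
    have hq : ∀ i, ¬ Quad r (bits s) (bits s) (bits s) i := by
      rintro i ⟨h1, h2, -, -⟩
      omega
    exact ⟨fun i => Or.inl ⟨rfl, rfl⟩, fun i hi => absurd hi (hq i)⟩
  | succ n ih =>
    rw [scan_hop_succ_apply r ω l n a _ t rfl] at h
    by_cases h1 : scan (hop r ω) l n a (Finsupp.single s 1) t = 0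
    · rw [h1, zero_add] at h
      split_ifs at h with h2
      · obtain ⟨w, hw⟩ := ih _ (left_ne_zero_of_mul h)
        exact ⟨_, hw.insert hr rfl h2.1 h2.2⟩
      · exact absurd rfl h
    · obtain ⟨w, hw⟩ := ih _ h1
      exact ⟨w, hw.mono⟩

lemma hgtAt_congr (r : ℕ) {w w' : ℤ → ℕ} {j : ℤ} (h : ∀ i, j - r < i → i < j → w i = w' i) :
    hgtAt r w j = hgtAt r w' j := by
  rw [hgtAt_eq_sum, hgtAt_eq_sum]
  refine Finset.sum_congr rfl fun i hi => ?_
  rw [Finset.mem_Ioo] at hi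
  exact h i hi.1 hi.2

theorem scan_hop_apply_of_witnessIn (r : ℕ) (hr : 1 ≤ r) (ω : ℕ → ℕ) (l : ℤ) (n : ℕ) (a : ℤ)
    {s t : ℤ → Bool} {w : ℤ → ℕ} (h : WitnessIn r l n s t w) :
    scan (hop r ω) l n a (Finsupp.single s 1) t =
      if a = {i | Quad r (bits s) (bits t) w i}.ncard then
        Polynomial.X ^ ∑ᶠ i ∈ {i | Quad r (bits s) (bits t) w i}, ω (hgtAt r w i) else 0 := by
  induction n generalizing a t w with
  | zero =>
    obtain rfl := h.eq_of_zero
    have hq : {i | Quad r (bits s) (bits s) w i} = ∅ := by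
      refine Set.eq_empty_iff_forall_notMem.mpr fun i hi => ?_
      have := h.2 i hi
      push_cast at this
      omega
    rw [hq, scan]
    simp only [Set.ncard_empty, finsum_mem_empty, Nat.cast_zero, pow_zero]
    split_ifs
    · simp
    · rfl
  | succ n ih =>
    obtain ⟨j, hj⟩ : ∃ j, j = l + n + 1 := ⟨_, rfl⟩
    rw [scan_hop_succ_apply r ω l n a _ t hj]
    by_cases hq : Quad r (bits s) (bits t) w j
    · have hjr : w j = bits t j := h.apply_of_lt' (by push_cast; omega)
      obtain ⟨h1, h2⟩ := h.erase hr hj hq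
      have h0 : scan (hop r ω) l n a (Finsupp.single s 1) t = 0 := by
        by_contra hc
        obtain ⟨w', hw'⟩ := exists_witnessIn_of_scan_hop_ne_zero r hr ω l n a hc
        have e1 := (hw'.apply_of_lt (i := j) (by omega)).2
        have e2 := hw'.apply_of_lt' (i := j) (by omega)
        have e3 := hq.2.2
        omega
      have hset : {i | Quad r (bits s) (bits t) w i} = insert j
          {i | Quad r (bits s) (bits (t ∘ Equiv.swap (j - r) j)) (Function.update w j 0) i} := by
        ext i
        simp only [Set.mem_insert_iff, Set.mem_ofPred_eq, h2]
        by_cases hij : i = j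
        · simp [hij, hq]
        · simp [hij]
      have hnot : j ∉
          {i | Quad r (bits s) (bits (t ∘ Equiv.swap (j - r) j)) (Function.update w j 0) i} :=
        fun hc => ((h2 j).mp hc).1 rfl
      have hht : ∑ᶠ i ∈ {i | Quad r (bits s) (bits (t ∘ Equiv.swap (j - r) j))
            (Function.update w j 0) i}, ω (hgtAt r (Function.update w j 0) i) =
          ∑ᶠ i ∈ {i | Quad r (bits s) (bits (t ∘ Equiv.swap (j - r) j))
            (Function.update w j 0) i}, ω (hgtAt r w i) := by
        refine finsum_mem_congr rfl fun i hi => ?_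
        have := (h1.2 i hi).2
        rw [hgtAt_congr r fun k _ hk => Function.update_of_ne (by omega) _ _]
      have hhj : hgtAt r (bits t) j = hgtAt r w j :=
        hgtAt_congr r fun k hk _ => (h.apply_of_lt' (by push_cast; omega)).symm
      rw [h0, zero_add, if_pos ⟨hq.2.1, by rw [← hjr]; exact hq.2.2.2⟩, ih (a - 1) h1, hset,
        Set.ncard_insert_of_notMem hnot h1.finite, finsum_mem_insert _ hnot h1.finite,
        hht, hhj]
      push_cast
      simp only [sub_eq_iff_eq_add]
      split_ifs
      · rw [← pow_add, add_comm]
      · rw [zero_mul]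
    · have hw : WitnessIn r l n s t w := by
        refine ⟨h.1, fun i hi => ⟨(h.2 i hi).1, ?_⟩⟩
        have := (h.2 i hi).2
        have : i ≠ j := by rintro rfl; exact hq hi
        push_cast at *
        omega
      rw [ih a hw]
      convert add_zero _
      rw [ite_eq_right_iff]
      rintro ⟨e1, e2⟩
      convert zero_mul _
      by_contra hc
      obtain ⟨w', hw'⟩ := exists_witnessIn_of_scan_hop_ne_zero r hr ω l n _ hc
      have e3 := (hw'.apply_of_lt (i := j) (by omega)).2
      have e4 := hw'.apply_of_lt' (i := j) (by omega)
      have e5 := (hw.apply_of_lt (i := j) (by omega)).2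
      have e6 := hw.apply_of_lt' (i := j) (by omega)
      rw [bits_swap_right] at e4
      omega

lemma IsWitness.exists_witnessIn {r : ℕ} {s t : ℤ → Bool} {w : ℤ → ℕ}
    (h : IsWitness r (bits s) (bits t) w) :
    ∃ M₀ : ℕ, ∀ M : ℕ, M₀ ≤ M → WitnessIn r (-M) (2 * M) s t w := by
  obtain ⟨b, hb⟩ := (h.2.image fun i => i.natAbs).bddAbove
  refine ⟨b + 1, fun M hM => ⟨h.1, fun i hi => ?_⟩⟩
  have : i.natAbs ≤ b := hb ⟨i, hi, rfl⟩
  push_cast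
  omega

lemma theWitness_spec {r : ℕ} {s t : ℤ → ℕ} (h : HStrip r s t) :
    IsWitness r s t (theWitness r s t) := by
  rw [theWitness, dif_pos h]
  exact h.choose_spec

lemma IsWitness.ncard_eq {r : ℕ} (hr : 1 ≤ r) {s t : ℤ → Bool} {w w' : ℤ → ℕ}
    (h : IsWitness r (bits s) (bits t) w) (h' : IsWitness r (bits s) (bits t) w') :
    {i | Quad r (bits s) (bits t) w i}.ncard = {i | Quad r (bits s) (bits t) w' i}.ncard := by
  obtain ⟨M, hM⟩ := h.exists_witnessIn
  obtain ⟨M', hM'⟩ := h'.exists_witnessIn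
  have h1 := scan_hop_apply_of_witnessIn r hr id _ _
    {i | Quad r (bits s) (bits t) w i}.ncard (hM (max M M') (le_max_left _ _))
  rw [scan_hop_apply_of_witnessIn r hr id _ _ _ (hM' (max M M') (le_max_right _ _)),
    if_pos rfl] at h1
  by_contra hc
  rw [if_neg (by exact_mod_cast hc)] at h1
  exact pow_ne_zero _ Polynomial.X_ne_zero h1.symm

lemma scan_hop_apply_of_isWitness (r : ℕ) (hr : 1 ≤ r) (ω : ℕ → ℕ) (l : ℤ) (n : ℕ) (a : ℕ)
    {s t : ℤ → Bool} {w : ℤ → ℕ} (h : IsWitness r (bits s) (bits t) w)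
    (hin : {i | Quad r (bits s) (bits t) w i}.ncard = a → WitnessIn r l n s t w) :
    scan (hop r ω) l n a (Finsupp.single s 1) t =
      if {i | Quad r (bits s) (bits t) w i}.ncard = a then
        Polynomial.X ^ ∑ᶠ i ∈ {i | Quad r (bits s) (bits t) w i}, ω (hgtAt r w i) else 0 := by
  split_ifs with ha
  · rw [scan_hop_apply_of_witnessIn r hr ω l n a (hin ha), if_pos (by exact_mod_cast ha.symm)]
  · by_contra hc
    obtain ⟨w', hw'⟩ := exists_witnessIn_of_scan_hop_ne_zero r hr ω l n a hc
    rw [scan_hop_apply_of_witnessIn r hr ω l n a hw', ← h.ncard_eq hr hw'.isWitness, if_neg] at hc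
    · exact hc rfl
    · exact fun hc' => ha (by exact_mod_cast hc'.symm)

lemma bits_eq_one {s : ℤ → Bool} {i : ℤ} : bits s i = 1 ↔ s i = true := by simp [bits]

lemma bits_eq_zero {s : ℤ → Bool} {i : ℤ} : bits s i = 0 ↔ s i = false := by simp [bits]

lemma raiseOp_eq_hop (r : ℕ) : raiseOp r = hop r id := rfl

lemma IsWitness.boundedBy {r : ℕ} (hr : 1 ≤ r) {s t : ℤ → Bool} {w : ℤ → ℕ} {B : ℤ}
    (h : IsWitness r (bits s) (bits t) w) (hB : BoundedBy B s) :
    BoundedBy (B + r * {i | Quad r (bits s) (bits t) w i}.ncard) t := by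
  obtain ⟨M, hM⟩ := h.exists_witnessIn
  have h1 := scan_hop_apply_of_witnessIn r hr id _ _
    {i | Quad r (bits s) (bits t) w i}.ncard (hM M le_rfl)
  rw [if_pos rfl] at h1
  have h2 := scan_raiseOp_mem_boundedPart r (-M) (2 * M) {i | Quad r (bits s) (bits t) w i}.ncard
    (single_mem_boundedPart hB 1)
  refine (Finsupp.mem_supported _ _).mp h2 (Finsupp.mem_support_iff.mpr ?_)
  rw [raiseOp_eq_hop, h1]
  exact pow_ne_zero _ Polynomial.X_ne_zero

lemma IsWitness.witnessIn_of_boundedBy {r : ℕ} (hr : 1 ≤ r) {s t : ℤ → Bool} {w : ℤ → ℕ}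
    {B B' l : ℤ} {n : ℕ}
    (h : IsWitness r (bits s) (bits t) w) (hs : BoundedBy B s) (ht : BoundedBy B' t)
    (hl : l < -B) (hn : B' ≤ l + n + 1) : WitnessIn r l n s t w := by
  refine ⟨h.1, fun i hi => ⟨?_, ?_⟩⟩
  · by_contra hc
    have := bits_eq_zero.mp hi.2.2.1
    rw [hs.1 i (by omega)] at this
    cases this
  · obtain ⟨m, hm, hmax⟩ := Set.exists_max_image _ id h.2 ⟨i, hi⟩
    refine (hmax i hi).trans ?_
    by_contra hc
    rcases h.1 (m + r) with h1 | h1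
    · have h2 := hm.2.2.2
      rw [← add_sub_cancel_right m (r : ℤ), h1.1, add_sub_cancel_right, bits_eq_one,
        ht.2 m (by simp only [id] at hc; omega)] at h2
      cases h2
    · have h2 := hmax (m + r) h1
      simp only [id] at h2
      omega

theorem scan_raiseOp_apply (r : ℕ) (hr : 1 ≤ r) (l : ℤ) (n : ℕ) (a : ℕ) {s t : ℤ → Bool} {B : ℤ}
    (hB : BoundedBy B s) (hl : l < -B) (hn : B + r * a ≤ l + n + 1) :
    scan (raiseOp r) l n a (Finsupp.single s 1) t =
      if HStrip r (bits s) (bits t) ∧ ribCount r (bits s) (bits t) = a then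
        Polynomial.X ^ twoSpin r (bits s) (bits t) else 0 := by
  by_cases h : HStrip r (bits s) (bits t)
  · have hw := theWitness_spec h
    rw [raiseOp_eq_hop, scan_hop_apply_of_isWitness r hr id l n a hw fun ha =>
      hw.witnessIn_of_boundedBy hr hB (hw.boundedBy hr hB) hl (by rwa [ha])]
    simp only [h, true_and]
    rfl
  · rw [if_neg fun h' => h h'.1]
    by_contra hc
    obtain ⟨w, hw⟩ := exists_witnessIn_of_scan_hop_ne_zero r hr id l n a hc
    exact h ⟨w, hw.isWitness⟩

lemma complOp_apply (v : Fock) (t : ℤ → Bool) : complOp v t = v fun i => !t i := by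
  have h : Function.Injective fun (s : ℤ → Bool) (i : ℤ) => !s i :=
    Function.Involutive.injective fun s => by simp
  conv_lhs => rw [show t = (fun (s : ℤ → Bool) (i : ℤ) => !s i) fun i => !t i by simp]
  exact Finsupp.mapDomain_apply h v _

lemma scan_lowerOp_eq (r : ℕ) (l : ℤ) (n : ℕ) (a : ℤ) :
    scan (lowerOp r) l n a = complOp * scan (hop r fun h => r - 1 - h) l n a * complOp := by
  induction n generalizing a with
  | zero =>
    rw [scan, scan]
    split_ifs
    · rw [mul_one, complOp_mul_complOp]
    · rw [mul_zero, zero_mul]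
  | succ n ih =>
    rw [scan, scan, ih, ih, lowerOp, mul_add, add_mul]
    congr 1
    simp only [mul_assoc]
    rw [← mul_assoc complOp complOp, complOp_mul_complOp, one_mul]

lemma quad_reflect (r : ℕ) (s t w : ℤ → ℕ) (i : ℤ) :
    Quad r (fun i => t (-1 - i)) (fun i => s (-1 - i)) (fun i => w (-1 - i)) i ↔
      Quad r s t w (r - 1 - i) := by
  rw [Quad, Quad, show -1 - (i - r) = r - 1 - i by ring, show r - 1 - i - r = -1 - i by ring]
  tauto

lemma IsWitness.reflect {r : ℕ} {s t w : ℤ → ℕ} (h : IsWitness r s t w) :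
    IsWitness r (fun i => t (-1 - i)) (fun i => s (-1 - i)) (fun i => w (-1 - i)) := by
  refine ⟨fun i => ?_, ?_⟩
  · rw [quad_reflect]
    refine (h.1 (r - 1 - i)).imp_left fun h => ?_
    rw [show r - 1 - i - r = -1 - i by ring] at h
    simp only [show -1 - (i - r) = r - 1 - i by ring]
    exact ⟨h.2.symm, h.1.symm⟩
  · simp only [quad_reflect]
    exact h.2.preimage (sub_right_injective.injOn)

lemma hgtAt_reflect (r : ℕ) (w : ℤ → ℕ) (i : ℤ) :
    hgtAt r (fun i => w (-1 - i)) i = hgtAt r w (r - 1 - i) := by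
  rw [hgtAt_eq_sum, hgtAt_eq_sum]
  refine Finset.sum_bij' (fun k _ => -1 - k) (fun k _ => -1 - k) ?_ ?_ ?_ ?_ ?_ <;>
    simp only [Finset.mem_Ioo] <;> intros <;> first | omega | trivial

lemma bits_not (s : ℤ → Bool) (i : ℤ) : bits (fun i => !s i) i = 1 - bits s i := by
  simp only [bits]
  cases s i <;> rfl

lemma revc_bits (s : ℤ → Bool) : revc (bits s) = fun i => bits (fun i => !s i) (-1 - i) := by
  funext i
  rw [bits_not, revc]

lemma IsWitness.witnessIn_of_boundedBy_not {r : ℕ} (hr : 1 ≤ r) {s t : ℤ → Bool} {w : ℤ → ℕ}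
    {B l : ℤ} {n : ℕ} (h : IsWitness r (bits fun i => !s i) (bits fun i => !t i) w)
    (hs : BoundedBy B s) (hl : l < -B) (hn : B ≤ l + n + 1) :
    WitnessIn r l n (fun i => !s i) (fun i => !t i) w := by
  refine ⟨h.1, fun i hi => ⟨?_, ?_⟩⟩
  · obtain ⟨m, hm, hmin⟩ := Set.exists_min_image _ id h.2 ⟨i, hi⟩
    refine lt_of_lt_of_le ?_ (hmin i hi)
    by_contra hc
    simp only [id] at hc
    rcases h.1 (m - r) with h1 | h1
    · have h2 := hm.1
      rw [← h1.2, bits_eq_one, hs.1 (m - r) (by omega)] at h2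
      cases h2
    · have h2 := hmin (m - r) h1
      simp only [id] at h2
      omega
  · by_contra hc
    have h2 := bits_eq_zero.mp hi.2.2.1
    rw [hs.2 i (by omega)] at h2
    cases h2

theorem scan_lowerOp_apply (r : ℕ) (hr : 1 ≤ r) (l : ℤ) (n : ℕ) (a : ℕ) {s t : ℤ → Bool} {B : ℤ}
    (hB : BoundedBy B s) (hl : l < -B) (hn : B ≤ l + n + 1) :
    scan (lowerOp r) l n a (Finsupp.single s 1) t =
      if VStrip r (bits t) (bits s) ∧ ribCount r (revc (bits t)) (revc (bits s)) = a then
        Polynomial.X ^ twoSpinV r (bits t) (bits s) else 0 := by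
  rw [scan_lowerOp_eq, Module.End.mul_apply, Module.End.mul_apply, complOp_apply, complOp_single]
  by_cases h : VStrip r (bits t) (bits s)
  · have hw := (theWitness_spec h)
    obtain ⟨w, hww⟩ : ∃ w : ℤ → ℕ, theWitness r (revc (bits t)) (revc (bits s)) =
      fun i => w (-1 - i) :=
    ⟨fun i => theWitness r (revc (bits t)) (revc (bits s)) (-1 - i), by simp⟩
    have hq : ∀ i, RibbonAt r (revc (bits t)) (revc (bits s)) i ↔
        Quad r (bits fun i => !s i) (bits fun i => !t i) w (r - 1 - i) := fun i => by
      rw [RibbonAt, hww, revc_bits, revc_bits, quad_reflect]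
    have hW : IsWitness r (bits fun i => !s i) (bits fun i => !t i) w := by
      rw [hww, revc_bits, revc_bits] at hw
      simpa using hw.reflect
    have hbij : Set.BijOn (fun i : ℤ => r - 1 - i)
        {i | RibbonAt r (revc (bits t)) (revc (bits s)) i}
        {i | Quad r (bits fun i => !s i) (bits fun i => !t i) w i} := by
      refine ⟨fun i hi => (hq i).mp hi, sub_right_injective.injOn, fun i hi =>
        ⟨r - 1 - i, (hq _).mpr ?_, by simp⟩⟩
      simpa using hi
    have hcount : ribCount r (revc (bits t)) (revc (bits s)) =
        {i | Quad r (bits fun i => !s i) (bits fun i => !t i) w i}.ncard := by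
      rw [← hbij.image_eq, Set.ncard_image_of_injective _ sub_right_injective]
      rfl
    have hspin : twoSpinV r (bits t) (bits s) =
        ∑ᶠ i ∈ {i | Quad r (bits fun i => !s i) (bits fun i => !t i) w i},
          (r - 1 - hgtAt r w i) := by
      refine finsum_mem_eq_of_bijOn _ hbij fun i _ => ?_
      rw [hww, hgtAt_reflect]
    rw [scan_hop_apply_of_isWitness r hr _ l n a hW fun _ =>
      hW.witnessIn_of_boundedBy_not hr hB hl hn, hcount, hspin]
    simp only [h, true_and]
  · rw [if_neg fun h' => h h'.1]
    by_contra hc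
    obtain ⟨w, hw⟩ := exists_witnessIn_of_scan_hop_ne_zero r hr _ l n a hc
    refine h ⟨fun i => w (-1 - i), ?_⟩
    rw [revc_bits, revc_bits]
    exact hw.isWitness.reflect

/-- The bit sequence `s` is bounded by `M` and has `M` ones in the window `[-M, M)`. -/
def BalancedBy (M : ℕ) (s : ℤ → Bool) : Prop :=
  BoundedBy M s ∧ ((Finset.Ico (-M : ℤ) M).filter fun k => s k = true).card = M

lemma BalancedBy.succ {M : ℕ} {s : ℤ → Bool} (h : BalancedBy M s) : BalancedBy (M + 1) s := by
  refine ⟨h.1.mono (by push_cast; omega), ?_⟩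
  have h1 := h.1.1 (-(M + 1)) (by omega)
  have h2 := h.1.2 M le_rfl
  have : (Finset.Ico (-((M + 1 : ℕ) : ℤ)) ((M + 1 : ℕ) : ℤ)).filter (fun k => s k = true) =
      insert (-(M + 1 : ℤ)) ((Finset.Ico (-M : ℤ) M).filter fun k => s k = true) := by
    ext k
    simp only [Finset.mem_filter, Finset.mem_Ico, Finset.mem_insert]
    push_cast
    constructor
    · rintro ⟨hk, hs⟩
      rcases eq_or_ne k (-(M + 1)) with hk1 | hk1
      · exact Or.inl hk1
      rcases eq_or_ne k M with hk2 | hk2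
      · rw [hk2, h2] at hs; cases hs
      exact Or.inr ⟨⟨by omega, by omega⟩, hs⟩
    · rintro (rfl | ⟨hk, hs⟩)
      · exact ⟨by omega, h1⟩
      · exact ⟨by omega, hs⟩
  rw [this, Finset.card_insert_of_notMem (by simp), h.2]

lemma BalancedBy.mono {M M' : ℕ} {s : ℤ → Bool} (h : BalancedBy M s) (hM : M ≤ M') :
    BalancedBy M' s := by
  induction M', hM using Nat.le_induction with
  | base => exact h
  | succ n _ ih => exact ih.succ

lemma BalancedBy.swap {M : ℕ} {s : ℤ → Bool} (h : BalancedBy M s) (a b : ℤ) :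
    ∃ M', BalancedBy M' (s ∘ Equiv.swap a b) := by
  obtain ⟨M', hM, ha, hb⟩ : ∃ M' : ℕ, M ≤ M' ∧ (-M' ≤ a ∧ a < M') ∧ -M' ≤ b ∧ b < M' :=
    ⟨M + a.natAbs + b.natAbs + 1, by omega, by omega, by omega⟩
  have h' := h.mono hM
  refine ⟨M', ⟨fun k hk => ?_, fun k hk => ?_⟩, ?_⟩
  · rw [Function.comp, Equiv.swap_apply_of_ne_of_ne (by omega) (by omega)]
    exact h'.1.1 k hk
  · rw [Function.comp, Equiv.swap_apply_of_ne_of_ne (by omega) (by omega)]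
    exact h'.1.2 k hk
  · have hmem : ∀ k, k ∈ Finset.Ico (-M' : ℤ) M' → Equiv.swap a b k ∈ Finset.Ico (-M' : ℤ) M' := by
      intro k hk
      rw [Equiv.swap_apply_def]
      split_ifs
      · exact Finset.mem_Ico.mpr hb
      · exact Finset.mem_Ico.mpr ha
      · exact hk
    refine Eq.trans ?_ h'.2
    refine Finset.card_bij' (fun k _ => Equiv.swap a b k) (fun k _ => Equiv.swap a b k) ?_ ?_ ?_ ?_
    · intro k hk
      rw [Finset.mem_filter] at hk ⊢
      exact ⟨hmem k hk.1, hk.2⟩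
    · intro k hk
      rw [Finset.mem_filter] at hk ⊢
      exact ⟨hmem k hk.1, by simpa using hk.2⟩
    · simp
    · simp

lemma balancedBy_of_edgeSeq {f : ℕ → ℕ} (hf : IsPartition f) {s : ℤ → Bool}
    (hs : bits s = edgeSeq f) : ∃ M, BalancedBy M s := by
  obtain ⟨hanti, N, hN⟩ := hf
  have hsk : ∀ k, s k = true ↔ ∃ j : ℕ, (f j : ℤ) - j - 1 = k := fun k => by
    rw [← bits_eq_one, hs, edgeSeq]
    split_ifs with h <;> simp [h]
  refine ⟨f 0 + N, ⟨fun k hk => ?_, fun k hk => ?_⟩, ?_⟩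
  · rw [hsk]
    refine ⟨(-1 - k).toNat, ?_⟩
    rw [hN _ (by omega)]
    omega
  · rw [← Bool.not_eq_true, hsk]
    rintro ⟨j, hj⟩
    have := hanti 0 j (by omega)
    push_cast at hk
    omega
  · rw [← Finset.card_range (f 0 + N)]
    symm
    refine Finset.card_bij (fun j _ => (f j : ℤ) - j - 1) ?_ ?_ ?_
    · intro j hj
      rw [Finset.mem_range] at hj
      rw [Finset.mem_filter, Finset.mem_Ico, hsk, Finset.card_range]
      have := hanti 0 j (by omega)
      exact ⟨by omega, j, rfl⟩
    · intro i _ j _ hij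
      rcases le_total i j with h | h
      · have := hanti _ _ h; omega
      · have := hanti _ _ h; omega
    · intro k hk
      rw [Finset.mem_filter, Finset.mem_Ico, hsk, Finset.card_range] at hk
      obtain ⟨hk, j, hj⟩ := hk
      refine ⟨j, ?_, hj⟩
      rw [Finset.mem_range]
      by_contra hc
      have := hN j (by omega)
      push_cast at hk
      omega

lemma BalancedBy.exists_edgeSeq {M : ℕ} {s : ℤ → Bool} (h : BalancedBy M s) :
    ∃ f, IsPartition f ∧ edgeSeq f = bits s := by
  set p : ℕ → Prop := fun m => s (M - 1 - m) = true with hp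
  have hcount : ∀ n, Nat.count p (2 * M + n) = M + n := by
    intro n
    induction n with
    | zero =>
      rw [Nat.count_eq_card_filter_range, add_zero, add_zero]
      conv_rhs => rw [← h.2]
      refine Finset.card_bij' (fun m _ => (M : ℤ) - 1 - m) (fun k _ => (M - 1 - k).toNat)
        ?_ ?_ ?_ ?_
      · intro m hm
        simp only [Finset.mem_filter, Finset.mem_range, Finset.mem_Ico] at hm ⊢
        exact ⟨by omega, hm.2⟩
      · intro k hk
        simp only [Finset.mem_filter, Finset.mem_range, Finset.mem_Ico, hp] at hk ⊢
        refine ⟨by omega, ?_⟩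
        rw [show (M : ℤ) - 1 - ((M - 1 - k).toNat : ℤ) = k by omega]
        exact hk.2
      · intro m _
        simp
      · intro k hk
        simp only [Finset.mem_filter, Finset.mem_Ico] at hk
        omega
    | succ n ih =>
      rw [← add_assoc, Nat.count_succ, ih, if_pos (h.1.1 _ (by push_cast; omega)), add_assoc]
  have hnth : ∀ j, M ≤ j → Nat.nth p j = j + M := by
    intro j hj
    obtain ⟨n, rfl⟩ := Nat.exists_eq_add_of_le hj
    rw [← hcount n, Nat.nth_count (h.1.1 _ (by push_cast; omega)), hcount]
    ring
  have hinf : (Set.ofPred p).Infinite := by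
    refine Set.infinite_of_not_bddAbove fun ⟨b, hb⟩ => ?_
    have := hb (show p (2 * M + b + 1) from h.1.1 _ (by push_cast; omega))
    omega
  have hmono := Nat.nth_strictMono hinf
  have hle : ∀ i d, Nat.nth p i + d ≤ Nat.nth p (i + d) := by
    intro i d
    induction d with
    | zero => simp
    | succ d ih =>
      have := hmono (show i + d < i + (d + 1) by omega)
      omega
  have hub : ∀ j, Nat.nth p j ≤ j + M := by
    intro j
    have h1 := hle j M
    have h2 := hnth (j + M) (by omega)
    omega
  refine ⟨fun j => j + M - Nat.nth p j, ⟨fun i j hij => ?_, M, fun n hn => ?_⟩, ?_⟩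
  · obtain ⟨d, rfl⟩ := Nat.exists_eq_add_of_le hij
    have := hle i d
    dsimp only
    omega
  · dsimp only
    rw [hnth n hn]
    omega
  · funext k
    have hk : (∃ j : ℕ, ((j + M - Nat.nth p j : ℕ) : ℤ) - j - 1 = k) ↔ s k = true := by
      constructor
      · rintro ⟨j, rfl⟩
        have h1 := hub j
        have h2 : s (M - 1 - Nat.nth p j) = true := Nat.nth_mem_of_infinite hinf j
        rw [← h2]
        congr 1
        omega
      · intro hs
        have hkM : k < M := by
          by_contra hc
          rw [h.1.2 k (by omega)] at hs
          cases hs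
        have hpk : p (M - 1 - k).toNat := by
          simp only [hp]
          rw [← hs]
          congr 1
          omega
        have h1 := Nat.nth_count hpk
        have h2 := hub (Nat.count p (M - 1 - k).toNat)
        exact ⟨_, by rw [h1] at h2 ⊢; omega⟩
    rw [edgeSeq]
    simp only [hk]
    rw [bits]
    cases s k <;> rfl

lemma edgeSeq_injOn : Set.InjOn edgeSeq {f | IsPartition f} := by
  intro f hf g hg hfg
  have hmono : ∀ f, IsPartition f → StrictMono fun j : ℕ => -((f j : ℤ) - j - 1) := by
    refine fun f hf => strictMono_nat_of_lt_succ fun j => ?_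
    have := hf.1 j (j + 1) (by omega)
    push_cast
    omega
  have hrange : Set.range (fun j : ℕ => -((f j : ℤ) - j - 1)) =
      Set.range (fun j : ℕ => -((g j : ℤ) - j - 1)) := by
    ext k
    have h1 : ∀ f : ℕ → ℕ, k ∈ Set.range (fun j : ℕ => -((f j : ℤ) - j - 1)) ↔
        edgeSeq f (-k) = 1 := fun f => by
      simp only [edgeSeq, Set.mem_range]
      split_ifs with h
      · obtain ⟨j, hj⟩ := h
        exact iff_of_true ⟨j, by omega⟩ rfl
      · exact iff_of_false (fun ⟨j, hj⟩ => h ⟨j, by omega⟩) (by simp)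
    rw [h1, h1, hfg]
  have := ((hmono f hf).range_inj (hmono g hg)).mp hrange
  funext j
  have := congrFun this j
  omega

/-- The edge sequence of a partition as a Boolean sequence. -/
noncomputable def boolSeq (f : ℕ → ℕ) (k : ℤ) : Bool := decide (edgeSeq f k = 1)

lemma bits_boolSeq (f : ℕ → ℕ) : bits (boolSeq f) = edgeSeq f := by
  funext k
  rw [bits, boolSeq, edgeSeq]
  split_ifs <;> simp

/-- The combinations of balanced bit sequences, i.e. of edge sequences of partitions. -/
noncomputable def balancedPart : Submodule (Polynomial ℕ) Fock :=
  Finsupp.supported (Polynomial ℕ) (Polynomial ℕ) {s | ∃ M, BalancedBy M s}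

lemma mem_of_mem_balancedPart {v : Fock} (hv : v ∈ balancedPart)
    {N : Submodule (Polynomial ℕ) Fock}
    (h : ∀ s, (∃ M, BalancedBy M s) → Finsupp.single s 1 ∈ N) : v ∈ N := by
  have hN : balancedPart ≤ N := by
    rw [balancedPart, Finsupp.supported_eq_span_single, Submodule.span_le]
    rintro _ ⟨s, hs, rfl⟩
    exact h s hs
  exact hN hv

lemma scan_mem {g : ℤ → Module.End (Polynomial ℕ) Fock} {N : Submodule (Polynomial ℕ) Fock}
    (h : ∀ j, ∀ v ∈ N, g j v ∈ N) (l : ℤ) (n : ℕ) (a : ℤ) {v : Fock} (hv : v ∈ N) :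
    scan g l n a v ∈ N := by
  induction n generalizing a with
  | zero =>
    rw [scan]
    split_ifs
    · exact hv
    · exact zero_mem _
  | succ n ih =>
    have := h (l + n + 1) _ (ih (a - 1))
    exact add_mem (ih a) this

lemma raiseOp_mem_balancedPart (r : ℕ) (j : ℤ) (v : Fock) (hv : v ∈ balancedPart) :
    raiseOp r j v ∈ balancedPart := by
  refine mem_of_mem_balancedPart hv (N := balancedPart.comap (raiseOp r j)) fun s ⟨M, hs⟩ => ?_
  rw [Submodule.mem_comap, raiseOp_single]
  split_ifs
  · exact Finsupp.single_mem_supported _ _ (hs.swap _ _)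
  · exact zero_mem _

lemma lowerOp_mem_balancedPart (r : ℕ) (j : ℤ) (v : Fock) (hv : v ∈ balancedPart) :
    lowerOp r j v ∈ balancedPart := by
  refine mem_of_mem_balancedPart hv (N := balancedPart.comap (lowerOp r j)) fun s ⟨M, hs⟩ => ?_
  rw [Submodule.mem_comap, lowerOp_single]
  split_ifs
  · exact Finsupp.single_mem_supported _ _ (hs.swap _ _)
  · exact zero_mem _

lemma hstrip_refl (r : ℕ) (s : ℤ → ℕ) : HStrip r s s := by
  have hq : ∀ i, ¬ Quad r s s s i := by
    rintro i ⟨h1, h2, -, -⟩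
    omega
  refine ⟨s, fun i => Or.inl ⟨rfl, rfl⟩, ?_⟩
  rw [show {i | Quad r s s s i} = ∅ from Set.eq_empty_iff_forall_notMem.mpr hq]
  exact Set.finite_empty

lemma ribCount_self {r : ℕ} (hr : 1 ≤ r) (s : ℤ → Bool) : ribCount r (bits s) (bits s) = 0 := by
  have hq : ∀ i, ¬ Quad r (bits s) (bits s) (bits s) i := by
    rintro i ⟨h1, h2, -, -⟩
    omega
  have hs : {i | Quad r (bits s) (bits s) (bits s) i} = ∅ :=
    Set.eq_empty_iff_forall_notMem.mpr hq
  have hw : IsWitness r (bits s) (bits s) (bits s) :=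
    ⟨fun i => Or.inl ⟨rfl, rfl⟩, by rw [hs]; exact Set.finite_empty⟩
  have := (theWitness_spec (hstrip_refl r (bits s))).ncard_eq hr hw
  rw [hs, Set.ncard_empty] at this
  exact this

lemma setOf_ribbonAt_eq_empty {r : ℕ} {s t : ℤ → ℕ} (h : HStrip r s t) (h0 : ribCount r s t = 0) :
    {i | RibbonAt r s t i} = ∅ :=
  (Set.ncard_eq_zero (theWitness_spec h).2).mp h0

lemma eq_of_ribCount_eq_zero {r : ℕ} {s t : ℤ → ℕ} (h : HStrip r s t)
    (h0 : ribCount r s t = 0) : s = t := by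
  have hq : ∀ i, ¬ Quad r s t (theWitness r s t) i :=
    Set.eq_empty_iff_forall_notMem.mp (setOf_ribbonAt_eq_empty h h0)
  funext i
  have h1 := (((theWitness_spec h).1 i).resolve_right (hq i)).2
  have h2 := (((theWitness_spec h).1 (i + r)).resolve_right (hq _)).1
  rw [add_sub_cancel_right] at h2
  rw [h1, h2]

lemma twoSpin_eq_zero {r : ℕ} {s t : ℤ → ℕ} (h : HStrip r s t) (h0 : ribCount r s t = 0) :
    twoSpin r s t = 0 := by
  rw [twoSpin, setOf_ribbonAt_eq_empty h h0, finsum_mem_empty]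

lemma twoSpinV_eq_zero {r : ℕ} {s t : ℤ → ℕ} (h : VStrip r s t)
    (h0 : ribCount r (revc s) (revc t) = 0) : twoSpinV r s t = 0 := by
  rw [twoSpinV, setOf_ribbonAt_eq_empty h h0, finsum_mem_empty]

/-- The sequences starting at `s`, constant from index `n` on, whose step at each `i < n` occurs
with a nonzero coefficient in `T i`. -/
noncomputable def pathSet (T : ℕ → Module.End (Polynomial ℕ) Fock) (s : ℤ → Bool) :
    ℕ → Finset (ℕ → ℤ → Bool)
  | 0 => {fun _ => s}
  | n + 1 => (pathSet T s n).biUnion fun Z => (T n (Finsupp.single (Z n) 1)).support.image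
      fun t i => if i ≤ n then Z i else t

/-- The product of the coefficients of the first `n` steps of `Z`. -/
noncomputable def pathWt (T : ℕ → Module.End (Polynomial ℕ) Fock) (Z : ℕ → ℤ → Bool) (n : ℕ) :
    Polynomial ℕ :=
  ∏ i ∈ Finset.range n, T i (Finsupp.single (Z i) 1) (Z (i + 1))

lemma mem_pathSet {T : ℕ → Module.End (Polynomial ℕ) Fock} {s : ℤ → Bool} {n : ℕ}
    {Z : ℕ → ℤ → Bool} : Z ∈ pathSet T s n ↔ Z 0 = s ∧ (∀ i ≥ n, Z i = Z n) ∧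
      ∀ i < n, T i (Finsupp.single (Z i) 1) (Z (i + 1)) ≠ 0 := by
  induction n generalizing Z with
  | zero =>
    simp only [pathSet, Finset.mem_singleton]
    constructor
    · rintro rfl
      exact ⟨rfl, fun _ _ => rfl, fun i hi => absurd hi (by omega)⟩
    · rintro ⟨h0, h1, -⟩
      funext i
      rw [h1 i (by omega), h0]
  | succ n ih =>
    simp only [pathSet, Finset.mem_biUnion, Finset.mem_image, Finsupp.mem_support_iff]
    constructor
    · rintro ⟨Z, hZ, t, ht, rfl⟩
      obtain ⟨h0, -, h2⟩ := ih.mp hZ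
      refine ⟨by simpa using h0, fun i hi => ?_, fun i hi => ?_⟩
      · dsimp only
        rw [if_neg (by omega), if_neg (by omega)]
      · rcases eq_or_ne i n with rfl | hn
        · simpa using ht
        · simpa [show i ≤ n by omega, show i + 1 ≤ n by omega] using h2 i (by omega)
    · rintro ⟨h0, h1, h2⟩
      refine ⟨fun i => if i ≤ n then Z i else Z n, ih.mpr ⟨by simpa using h0, fun i hi => ?_,
        fun i hi => ?_⟩, Z (n + 1), ?_, ?_⟩
      · rcases eq_or_ne i n with rfl | hn
        · rfl
        · rw [if_neg (by omega), if_pos le_rfl]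
      · simpa [show i ≤ n by omega, show i + 1 ≤ n by omega] using h2 i (by omega)
      · simpa using h2 n (by omega)
      · funext i
        dsimp only
        split_ifs with hi
        · rfl
        · rw [h1 i (by omega)]

lemma iterApply_single (T : ℕ → Module.End (Polynomial ℕ) Fock) (s : ℤ → Bool) (n : ℕ) :
    iterApply T id (Finsupp.single s 1) n =
      ∑ Z ∈ pathSet T s n, pathWt T Z n • Finsupp.single (Z n) 1 := by
  induction n with
  | zero => simp [iterApply, pathSet, pathWt]
  | succ n ih =>
    rw [iterApply, ih, map_sum, pathSet, Finset.sum_biUnion]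
    · refine Finset.sum_congr rfl fun Z hZ => ?_
      rw [Finset.sum_image]
      · rw [map_smul]
        conv_lhs => rw [id, ← Finsupp.sum_single (T n (Finsupp.single (Z n) 1))]
        rw [Finsupp.sum, Finset.smul_sum]
        refine Finset.sum_congr rfl fun t _ => ?_
        simp only [pathWt]
        rw [Finset.prod_range_succ, if_pos le_rfl, if_neg (Nat.not_succ_le_self n), mul_smul]
        congr 1
        · refine Finset.prod_congr rfl fun i hi => ?_
          rw [Finset.mem_range] at hi
          rw [if_pos (by omega), if_pos (by omega)]
        · rw [Finsupp.smul_single, smul_eq_mul, mul_one]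
      · intro t _ t' _ htt
        simpa using congrFun htt (n + 1)
    · intro Z hZ Z' hZ' hne
      rw [Function.onFun, Finset.disjoint_left]
      intro Y hY hY'
      obtain ⟨t, -, rfl⟩ := Finset.mem_image.mp hY
      obtain ⟨t', -, h⟩ := Finset.mem_image.mp hY'
      refine hne (funext fun i => ?_)
      have key : ∀ i ≤ n, Z i = Z' i := fun i hi => by
        have := congrFun h i
        simpa [hi] using this.symm
      rcases le_total i n with hi | hi
      · exact key i hi
      · rw [(mem_pathSet.mp hZ).2.1 i hi, (mem_pathSet.mp hZ').2.1 i hi, key n le_rfl]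

lemma iterApply_single_apply (T : ℕ → Module.End (Polynomial ℕ) Fock) (s t : ℤ → Bool) (n : ℕ) :
    iterApply T id (Finsupp.single s 1) n t = ∑ᶠ Z ∈ {Z : ℕ → ℤ → Bool | Z 0 = s ∧
      (∀ i ≥ n, Z i = t) ∧ ∀ i < n, T i (Finsupp.single (Z i) 1) (Z (i + 1)) ≠ 0},
        pathWt T Z n := by
  have : {Z : ℕ → ℤ → Bool | Z 0 = s ∧ (∀ i ≥ n, Z i = t) ∧
      ∀ i < n, T i (Finsupp.single (Z i) 1) (Z (i + 1)) ≠ 0} =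
      ((pathSet T s n).filter fun Z => Z n = t : Finset _) := by
    ext Z
    simp only [Set.mem_ofPred_eq, Finset.coe_filter, mem_pathSet]
    constructor
    · rintro ⟨h0, h1, h2⟩
      have h3 := h1 n le_rfl
      exact ⟨⟨h0, fun i hi => by rw [h1 i hi, h3], h2⟩, h3⟩
    · rintro ⟨⟨h0, h1, h2⟩, rfl⟩
      exact ⟨h0, h1, h2⟩
  rw [this, finsum_mem_coe_finset, Finset.sum_filter, iterApply_single, Finsupp.finsetSum_apply]
  refine Finset.sum_congr rfl fun Z _ => ?_
  rw [Finsupp.smul_apply, Finsupp.single_apply, smul_eq_mul]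
  split_ifs <;> simp

/-- First the raising operators of degrees `α 0, …, α (n - 1)`, then the lowering operators of
degrees `β (n - 1), …, β 0`. -/
noncomputable def zigzagOp (r : ℕ) (l : ℤ) (N n : ℕ) (α β : ℕ → ℕ) (i : ℕ) :
    Module.End (Polynomial ℕ) Fock :=
  if i < n then scan (raiseOp r) l N (α i) else scan (lowerOp r) l N (β (2 * n - 1 - i))

/-- The step from `s` to `t` at index `i` adds a horizontal strip of weight `α i` if `i < n`, and
removes a vertical strip of weight `β (2 * n - 1 - i)` otherwise. -/
def IsZigzagStep (r n : ℕ) (α β : ℕ → ℕ) (i : ℕ) (s t : ℤ → Bool) : Prop :=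
  if i < n then HStrip r (bits s) (bits t) ∧ ribCount r (bits s) (bits t) = α i
  else VStrip r (bits t) (bits s) ∧
    ribCount r (revc (bits t)) (revc (bits s)) = β (2 * n - 1 - i)

/-- Twice the spin of the strip between `s` and `t` at index `i`. -/
noncomputable def zigzagTwoSpin (r n i : ℕ) (s t : ℤ → Bool) : ℕ :=
  if i < n then twoSpin r (bits s) (bits t) else twoSpinV r (bits t) (bits s)

lemma zigzagOp_apply {r : ℕ} (hr : 1 ≤ r) {l : ℤ} {N n : ℕ} {α β : ℕ → ℕ} {K : ℕ}
    (hα : ∀ i, α i ≤ K) {B : ℤ} {s t : ℤ → Bool} (hB : BoundedBy B s) (hl : l < -B)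
    (hN : B + r * K ≤ l + N + 1) (i : ℕ) :
    zigzagOp r l N n α β i (Finsupp.single s 1) t =
      if IsZigzagStep r n α β i s t then Polynomial.X ^ zigzagTwoSpin r n i s t else 0 := by
  have h1 : (0 : ℤ) ≤ r * K := by positivity
  have h2 : (r : ℤ) * α i ≤ r * K :=
    mul_le_mul_of_nonneg_left (by exact_mod_cast hα i) (by positivity)
  by_cases hi : i < n
  · simp only [zigzagOp, IsZigzagStep, zigzagTwoSpin, if_pos hi]
    exact scan_raiseOp_apply r hr l N (α i) hB hl (by omega)
  · simp only [zigzagOp, IsZigzagStep, zigzagTwoSpin, if_neg hi]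
    exact scan_lowerOp_apply r hr l N _ hB hl (by omega)

lemma boundedBy_of_zigzagOp_ne_zero {r : ℕ} {l : ℤ} {N n : ℕ} {α β : ℕ → ℕ} {K : ℕ}
    (hα : ∀ i, α i ≤ K) {B : ℤ} {s t : ℤ → Bool} (hB : BoundedBy B s) {i : ℕ}
    (h : zigzagOp r l N n α β i (Finsupp.single s 1) t ≠ 0) : BoundedBy (B + r * K) t := by
  have hmem : zigzagOp r l N n α β i (Finsupp.single s 1) ∈ boundedPart (B + r * K) := by
    rw [zigzagOp]
    split_ifs
    · refine boundedPart_mono ?_ (scan_raiseOp_mem_boundedPart r l N _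
        (single_mem_boundedPart hB 1))
      gcongr
      exact hα i
    · exact boundedPart_mono (le_add_of_nonneg_right (by positivity))
        (scan_lowerOp_mem_boundedPart r l N _ (single_mem_boundedPart hB 1))
  exact hmem (Finsupp.mem_support_iff.mpr h)

lemma balancedBy_of_zigzagOp_ne_zero {r : ℕ} {l : ℤ} {N n : ℕ} {α β : ℕ → ℕ} {s t : ℤ → Bool}
    (hs : ∃ M, BalancedBy M s) {i : ℕ}
    (h : zigzagOp r l N n α β i (Finsupp.single s 1) t ≠ 0) : ∃ M, BalancedBy M t := by
  have hmem : zigzagOp r l N n α β i (Finsupp.single s 1) ∈ balancedPart := by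
    have hs' : Finsupp.single s 1 ∈ balancedPart := Finsupp.single_mem_supported _ _ hs
    rw [zigzagOp]
    split_ifs
    · exact scan_mem (raiseOp_mem_balancedPart r) _ _ _ hs'
    · exact scan_mem (lowerOp_mem_balancedPart r) _ _ _ hs'
  exact hmem (Finsupp.mem_support_iff.mpr h)

lemma revApply_iterApply_eq_zigzag (r : ℕ) (l : ℤ) (N n : ℕ) (α β : ℕ → ℕ) (v : Fock) :
    revApply (scan (lowerOp r) l N) (fun i => β i) n
      (iterApply (scan (raiseOp r) l N) (fun i => (α i : ℤ)) v n) =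
      iterApply (zigzagOp r l N n α β) id v (2 * n) := by
  have h1 : iterApply (scan (raiseOp r) l N) (fun i => (α i : ℤ)) v n =
      iterApply (zigzagOp r l N n α β) id v n :=
    iterApply_congr v fun j hj => by rw [id, zigzagOp, if_pos hj]
  have h2 : ∀ k ≤ n, revApply (scan (lowerOp r) l N) (fun i => β i) k
      (iterApply (zigzagOp r l N n α β) id v (2 * n - k)) =
      iterApply (zigzagOp r l N n α β) id v (2 * n) := by
    intro k hk
    induction k with
    | zero => rfl
    | succ k ih =>
      rw [← ih (by omega), revApply, Module.End.mul_apply,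
        show 2 * n - k = 2 * n - (k + 1) + 1 by omega, iterApply, id, zigzagOp,
        if_neg (by omega), show 2 * n - 1 - (2 * n - (k + 1)) = k by omega]
  rw [h1, ← h2 n le_rfl]
  congr 2
  omega

lemma zigzagOp_apply_of_path {r : ℕ} (hr : 1 ≤ r) {l : ℤ} {N n : ℕ} {α β : ℕ → ℕ} {K : ℕ}
    (hα : ∀ i, α i ≤ K) {B : ℤ} {Z : ℕ → ℤ → Bool} (hB : BoundedBy B (Z 0)) {m : ℕ}
    (hl : l < -(B + r * K * m)) (hN : B + r * K * m ≤ l + N + 1)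
    (hZ : ∀ i < m, zigzagOp r l N n α β i (Finsupp.single (Z i) 1) (Z (i + 1)) ≠ 0 ∨
      IsZigzagStep r n α β i (Z i) (Z (i + 1))) {i : ℕ} (hi : i < m) :
    zigzagOp r l N n α β i (Finsupp.single (Z i) 1) (Z (i + 1)) =
      if IsZigzagStep r n α β i (Z i) (Z (i + 1))
      then Polynomial.X ^ zigzagTwoSpin r n i (Z i) (Z (i + 1)) else 0 := by
  have hle : ∀ k < m, (r : ℤ) * K * k + r * K ≤ r * K * m := by
    intro k hk
    rw [← mul_add_one]
    gcongr
    exact_mod_cast hk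
  have happly : ∀ k < m, BoundedBy (B + r * K * k) (Z k) →
      zigzagOp r l N n α β k (Finsupp.single (Z k) 1) (Z (k + 1)) =
      if IsZigzagStep r n α β k (Z k) (Z (k + 1))
      then Polynomial.X ^ zigzagTwoSpin r n k (Z k) (Z (k + 1)) else 0 := by
    intro k hk hZk
    have h1 := hle k hk
    have h2 : (0 : ℤ) ≤ r * K := by positivity
    exact zigzagOp_apply hr hα hZk (by omega) (by omega) k
  have hbd : ∀ k ≤ m, BoundedBy (B + r * K * k) (Z k) := by
    intro k
    induction k with
    | zero => intro _; simpa using hB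
    | succ k ih =>
      intro hk
      have hZk := ih (by omega)
      have hne : zigzagOp r l N n α β k (Finsupp.single (Z k) 1) (Z (k + 1)) ≠ 0 := by
        rcases hZ k hk with h | h
        · exact h
        · rw [happly k hk hZk, if_pos h]
          exact (Polynomial.monic_X_pow _).ne_zero
      refine (boundedBy_of_zigzagOp_ne_zero hα hZk hne).mono (le_of_eq ?_)
      push_cast
      ring
  exact happly i hi (hbd i hi.le)

/-- The closed sequences of `2 * n` steps at `s` that add horizontal strips and then remove
vertical ones, of the given weights. -/
def zigzags (r n : ℕ) (α β : ℕ → ℕ) (s : ℤ → Bool) : Set (ℕ → ℤ → Bool) :=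
  {Z | Z 0 = s ∧ (∀ i ≥ 2 * n, Z i = s) ∧ ∀ i < 2 * n, IsZigzagStep r n α β i (Z i) (Z (i + 1))}

lemma iterApply_zigzagOp {r : ℕ} (hr : 1 ≤ r) {l : ℤ} {N n : ℕ} {α β : ℕ → ℕ} {K : ℕ}
    (hα : ∀ i, α i ≤ K) {B : ℤ} {s : ℤ → Bool} (hB : BoundedBy B s)
    (hl : l < -(B + r * K * (2 * n : ℕ))) (hN : B + r * K * (2 * n : ℕ) ≤ l + N + 1) :
    iterApply (zigzagOp r l N n α β) id (Finsupp.single s 1) (2 * n) s =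
      ∑ᶠ Z ∈ zigzags r n α β s, (Polynomial.X : Polynomial ℕ) ^
        ∑ i ∈ Finset.range (2 * n), zigzagTwoSpin r n i (Z i) (Z (i + 1)) := by
  rw [iterApply_single_apply]
  refine finsum_mem_congr (Set.ext fun Z => ?_) fun Z hZ => ?_
  · refine and_congr_right fun h0 => and_congr_right fun _ => ⟨fun h i hi => ?_, fun h i hi => ?_⟩
    · have h1 := h i hi
      rw [zigzagOp_apply_of_path hr hα (h0 ▸ hB) hl hN (fun i hi => Or.inl (h i hi)) hi] at h1
      by_contra hc
      exact h1 (if_neg hc)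
    · rw [zigzagOp_apply_of_path hr hα (h0 ▸ hB) hl hN (fun i hi => Or.inr (h i hi)) hi,
        if_pos (h i hi)]
      exact (Polynomial.monic_X_pow _).ne_zero
  · obtain ⟨h0, -, h⟩ := hZ
    rw [pathWt, ← Finset.prod_pow_eq_pow_sum]
    refine Finset.prod_congr rfl fun i hi => ?_
    rw [Finset.mem_range] at hi
    rw [zigzagOp_apply_of_path hr hα (h0 ▸ hB) hl hN (fun i hi => Or.inr (h i hi)) hi,
      if_pos (h i hi)]

lemma balancedBy_of_mem_zigzags {r : ℕ} (hr : 1 ≤ r) {n : ℕ} {α β : ℕ → ℕ} {s : ℤ → Bool}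
    (hs : ∃ M, BalancedBy M s) {K : ℕ} (hα : ∀ i, α i ≤ K) {Z : ℕ → ℤ → Bool}
    (hZ : Z ∈ zigzags r n α β s) (i : ℕ) : ∃ M, BalancedBy M (Z i) := by
  obtain ⟨h0, h1, h2⟩ := hZ
  rcases le_or_gt (2 * n) i with hi | hi
  · rwa [h1 i hi]
  obtain ⟨M, hM⟩ := hs
  set C : ℕ := M + r * K * (2 * n) with hC
  have hC' : (C : ℤ) = M + r * K * (2 * n : ℕ) := by rw [hC]; push_cast; ring
  have key : ∀ k ≤ 2 * n, ∃ M, BalancedBy M (Z k) := by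
    intro k
    induction k with
    | zero => intro _; rw [h0]; exact ⟨M, hM⟩
    | succ k ih =>
      intro hk
      refine balancedBy_of_zigzagOp_ne_zero (r := r) (l := -C - 1) (N := 2 * C) (n := n) (α := α)
        (β := β) (ih (by omega)) (i := k) ?_
      rw [zigzagOp_apply_of_path hr hα (B := M) (by rw [h0]; exact hM.1) (m := 2 * n) (by omega)
        (by omega) (fun i hi => Or.inr (h2 i hi)) hk, if_pos (h2 k hk)]
      exact (Polynomial.monic_X_pow _).ne_zero
  exact key i hi.le

lemma revc_bits_eq_bits (s : ℤ → Bool) : revc (bits s) = bits fun i => !s (-1 - i) :=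
  revc_bits s

lemma revc_revc_bits (s : ℤ → Bool) : revc (revc (bits s)) = bits s := by
  rw [revc_bits_eq_bits, revc_bits_eq_bits]
  simp

lemma edgeSeq_eq_of_revc_eq {f g : ℕ → ℕ} (h : revc (edgeSeq f) = revc (edgeSeq g)) :
    edgeSeq f = edgeSeq g := by
  rw [← bits_boolSeq, ← bits_boolSeq] at h ⊢
  rw [← revc_revc_bits, h, revc_revc_bits]

lemma eq_of_boolSeq_eq {f g : ℕ → ℕ} (hf : IsPartition f) (hg : IsPartition g)
    (h : boolSeq f = boolSeq g) : f = g :=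
  edgeSeq_injOn hf hg (by rw [← bits_boolSeq, h, bits_boolSeq])

lemma boolSeq_eq_of_edgeSeq_eq {f : ℕ → ℕ} {s : ℤ → Bool} (h : edgeSeq f = bits s) :
    boolSeq f = s :=
  bits_injective (by rw [bits_boolSeq, h])

lemma IsSSRT.eq_of_le {r : ℕ} {γ : ℕ → ℕ} {P : ℕ → ℕ → ℕ} (hP : IsSSRT r γ P) {n : ℕ}
    (h : ∀ i ≥ n, chainWt r P i = 0) : ∀ i ≥ n, P i = P n := by
  intro i hi
  induction i, hi using Nat.le_induction with
  | base => rfl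
  | succ i hi ih =>
    rw [← ih]
    exact (edgeSeq_injOn (hP.2.1 _) (hP.2.1 _) (eq_of_ribCount_eq_zero (hP.2.2 i) (h i hi))).symm

lemma IsTSSRT.eq_of_le {r : ℕ} {γ : ℕ → ℕ} {Q : ℕ → ℕ → ℕ} (hQ : IsTSSRT r γ Q) {n : ℕ}
    (h : ∀ i ≥ n, chainWtV r Q i = 0) : ∀ i ≥ n, Q i = Q n := by
  intro i hi
  induction i, hi using Nat.le_induction with
  | base => rfl
  | succ i hi ih =>
    rw [← ih]
    exact (edgeSeq_injOn (hQ.2.1 _) (hQ.2.1 _)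
      (edgeSeq_eq_of_revc_eq (eq_of_ribCount_eq_zero (hQ.2.2 i) (h i hi)))).symm

lemma IsSSRT.chainTwoSpin_eq {r : ℕ} {γ : ℕ → ℕ} {P : ℕ → ℕ → ℕ} (hP : IsSSRT r γ P) {n : ℕ}
    (h : ∀ i ≥ n, chainWt r P i = 0) : chainTwoSpin r P =
      ∑ i ∈ Finset.range n, twoSpin r (edgeSeq (P i)) (edgeSeq (P (i + 1))) := by
  refine finsum_eq_sum_of_support_subset _ fun i hi => ?_
  rw [Finset.coe_range, Set.mem_Iio]
  by_contra hc
  exact hi (twoSpin_eq_zero (hP.2.2 i) (h i (not_lt.mp hc)))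

lemma IsTSSRT.chainTwoSpinV_eq {r : ℕ} {γ : ℕ → ℕ} {Q : ℕ → ℕ → ℕ} (hQ : IsTSSRT r γ Q) {n : ℕ}
    (h : ∀ i ≥ n, chainWtV r Q i = 0) : chainTwoSpinV r Q =
      ∑ i ∈ Finset.range n, twoSpinV r (edgeSeq (Q i)) (edgeSeq (Q (i + 1))) := by
  refine finsum_eq_sum_of_support_subset _ fun i hi => ?_
  rw [Finset.coe_range, Set.mem_Iio]
  by_contra hc
  exact hi (twoSpinV_eq_zero (hQ.2.2 i) (h i (not_lt.mp hc)))

/-- The pairs of a semistandard and a transpose semistandard ribbon tableau of equal shape and of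
the given weights. -/
def tableauPairs (r : ℕ) (γ : ℕ → ℕ) (α β : ℕ → ℕ) : Set ((ℕ → ℕ → ℕ) × (ℕ → ℕ → ℕ)) :=
  {PQ | IsSSRT r γ PQ.1 ∧ IsTSSRT r γ PQ.2 ∧
    (∀ i, chainWt r PQ.1 i = α i) ∧ (∀ i, chainWtV r PQ.2 i = β i) ∧
    ∃ N : ℕ, ∀ i : ℕ, N ≤ i → PQ.1 i = PQ.2 i}

/-- Walk up along the first tableau, then down along the second one. -/
noncomputable def zigzagOfPair (n : ℕ) (PQ : (ℕ → ℕ → ℕ) × (ℕ → ℕ → ℕ)) (i : ℕ) : ℤ → Bool :=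
  if i ≤ n then boolSeq (PQ.1 i) else boolSeq (PQ.2 (2 * n - i))

section

variable {r n : ℕ} {γ α β : ℕ → ℕ} {PQ : (ℕ → ℕ → ℕ) × (ℕ → ℕ → ℕ)}

lemma eq_of_mem_tableauPairs (hα : ∀ i ≥ n, α i = 0) (hβ : ∀ i ≥ n, β i = 0)
    (hPQ : PQ ∈ tableauPairs r γ α β) :
    (∀ i ≥ n, PQ.1 i = PQ.1 n) ∧ (∀ i ≥ n, PQ.2 i = PQ.2 n) ∧ PQ.1 n = PQ.2 n := by
  obtain ⟨hP, hQ, hPw, hQw, N, hN⟩ := hPQ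
  have h1 := hP.eq_of_le (n := n) fun i hi => by rw [hPw, hα i hi]
  have h2 := hQ.eq_of_le (n := n) fun i hi => by rw [hQw, hβ i hi]
  refine ⟨h1, h2, ?_⟩
  rw [← h1 (max n N) (le_max_left _ _), ← h2 (max n N) (le_max_left _ _),
    hN _ (le_max_right _ _)]

lemma zigzagOfPair_of_ge (hα : ∀ i ≥ n, α i = 0) (hβ : ∀ i ≥ n, β i = 0)
    (hPQ : PQ ∈ tableauPairs r γ α β) {i : ℕ} (hi : n ≤ i) :
    zigzagOfPair n PQ i = boolSeq (PQ.2 (2 * n - i)) := by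
  rw [zigzagOfPair]
  split_ifs with h
  · obtain rfl : i = n := le_antisymm h hi
    rw [(eq_of_mem_tableauPairs hα hβ hPQ).2.2, show 2 * i - i = i by omega]
  · rfl

lemma zigzagOfPair_mem (hα : ∀ i ≥ n, α i = 0) (hβ : ∀ i ≥ n, β i = 0)
    (hPQ : PQ ∈ tableauPairs r γ α β) :
    zigzagOfPair n PQ ∈ zigzags r n α β (boolSeq γ) := by
  have hge := fun i hi => zigzagOfPair_of_ge hα hβ hPQ (i := i) hi
  obtain ⟨hP, hQ, hPw, hQw, -⟩ := hPQ
  refine ⟨by rw [zigzagOfPair, if_pos (Nat.zero_le _), hP.1], fun i hi => ?_, fun i hi => ?_⟩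
  · rw [hge i (by omega), show 2 * n - i = 0 by omega, hQ.1]
  · rw [IsZigzagStep]
    split_ifs with h
    · rw [zigzagOfPair, zigzagOfPair, if_pos h.le, if_pos (by omega), bits_boolSeq, bits_boolSeq]
      exact ⟨hP.2.2 i, hPw i⟩
    · rw [hge i (by omega), hge (i + 1) (by omega), bits_boolSeq, bits_boolSeq,
        show 2 * n - i = 2 * n - 1 - i + 1 by omega, show 2 * n - (i + 1) = 2 * n - 1 - i by omega]
      exact ⟨hQ.2.2 _, hQw _⟩

lemma sum_zigzagTwoSpin_zigzagOfPair (hα : ∀ i ≥ n, α i = 0) (hβ : ∀ i ≥ n, β i = 0)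
    (hPQ : PQ ∈ tableauPairs r γ α β) :
    ∑ i ∈ Finset.range (2 * n),
      zigzagTwoSpin r n i (zigzagOfPair n PQ i) (zigzagOfPair n PQ (i + 1)) =
      chainTwoSpin r PQ.1 + chainTwoSpinV r PQ.2 := by
  have hge := fun i hi => zigzagOfPair_of_ge hα hβ hPQ (i := i) hi
  obtain ⟨hP, hQ, hPw, hQw, -⟩ := hPQ
  rw [hP.chainTwoSpin_eq (n := n) fun i hi => by rw [hPw, hα i hi],
    hQ.chainTwoSpinV_eq (n := n) fun i hi => by rw [hQw, hβ i hi], two_mul, Finset.sum_range_add,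
    ← Finset.sum_range_reflect (fun i => twoSpinV r _ _)]
  congr 1
  · refine Finset.sum_congr rfl fun i hi => ?_
    rw [Finset.mem_range] at hi
    rw [zigzagTwoSpin, if_pos hi, zigzagOfPair, zigzagOfPair, if_pos hi.le, if_pos (by omega),
      bits_boolSeq, bits_boolSeq]
  · refine Finset.sum_congr rfl fun i hi => ?_
    rw [Finset.mem_range] at hi
    rw [zigzagTwoSpin, if_neg (by omega), hge _ (by omega), hge _ (by omega), bits_boolSeq,
      bits_boolSeq, show 2 * n - (n + i) = n - 1 - i + 1 by omega,
      show 2 * n - (n + i + 1) = n - 1 - i by omega]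

lemma zigzagOfPair_injOn (hα : ∀ i ≥ n, α i = 0) (hβ : ∀ i ≥ n, β i = 0) :
    Set.InjOn (zigzagOfPair n) (tableauPairs r γ α β) := by
  intro x hx y hy hxy
  have hx' := eq_of_mem_tableauPairs hα hβ hx
  have hy' := eq_of_mem_tableauPairs hα hβ hy
  have h1 : ∀ i ≤ n, x.1 i = y.1 i := fun i hi => by
    have := congrFun hxy i
    rw [zigzagOfPair, zigzagOfPair, if_pos hi, if_pos hi] at this
    exact eq_of_boolSeq_eq (hx.1.2.1 i) (hy.1.2.1 i) this
  have h2 : ∀ i ≤ n, x.2 i = y.2 i := fun i hi => by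
    have := congrFun hxy (2 * n - i)
    rw [zigzagOfPair_of_ge hα hβ hx (by omega), zigzagOfPair_of_ge hα hβ hy (by omega),
      Nat.sub_sub_self (by omega)] at this
    exact eq_of_boolSeq_eq (hx.2.1.2.1 i) (hy.2.1.2.1 i) this
  refine Prod.ext (funext fun i => ?_) (funext fun i => ?_)
  · rcases le_total i n with hi | hi
    · exact h1 i hi
    · rw [hx'.1 i hi, hy'.1 i hi, h1 n le_rfl]
  · rcases le_total i n with hi | hi
    · exact h2 i hi
    · rw [hx'.2.1 i hi, hy'.2.1 i hi, h2 n le_rfl]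

lemma zigzagOfPair_surjOn (hr : 1 ≤ r) (hγ : IsPartition γ) (hα : ∀ i ≥ n, α i = 0)
    (hβ : ∀ i ≥ n, β i = 0) {K : ℕ} (hK : ∀ i, α i ≤ K) :
    Set.SurjOn (zigzagOfPair n) (tableauPairs r γ α β) (zigzags r n α β (boolSeq γ)) := by
  intro Z hZ
  have hbal : ∀ i, ∃ f, IsPartition f ∧ edgeSeq f = bits (Z i) := fun i => by
    obtain ⟨M, hM⟩ := balancedBy_of_mem_zigzags hr (balancedBy_of_edgeSeq hγ (bits_boolSeq γ)) hK
      hZ i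
    exact hM.exists_edgeSeq
  choose f hf hfZ using hbal
  obtain ⟨h0, h1, h2⟩ := hZ
  have hfγ : ∀ i, Z i = boolSeq γ → f i = γ := fun i hi =>
    edgeSeq_injOn (hf i) hγ (by rw [hfZ, hi, bits_boolSeq])
  refine ⟨⟨fun i => f (min i n), fun i => f (2 * n - min i n)⟩, ⟨⟨?_, fun i => hf _, fun i => ?_⟩,
    ⟨?_, fun i => hf _, fun i => ?_⟩, fun i => ?_, fun i => ?_, n, fun i hi => ?_⟩, ?_⟩
  · simpa using hfγ 0 h0
  · rcases lt_or_ge i n with hi | hi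
    · have := h2 i (by omega)
      rw [IsZigzagStep, if_pos hi] at this
      simpa only [hfZ, min_eq_left hi.le, min_eq_left (show i + 1 ≤ n from hi)] using this.1
    · simp only [min_eq_right hi, min_eq_right (show n ≤ i + 1 by omega)]
      exact hstrip_refl _ _
  · simpa using hfγ (2 * n) (h1 _ le_rfl)
  · rcases lt_or_ge i n with hi | hi
    · have := h2 (2 * n - 1 - i) (by omega)
      rw [IsZigzagStep, if_neg (by omega), show 2 * n - 1 - i + 1 = 2 * n - i by omega,
        show 2 * n - 1 - i = 2 * n - (i + 1) by omega] at this
      simpa only [hfZ, min_eq_left hi.le, min_eq_left (show i + 1 ≤ n from hi)] using this.1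
    · simp only [min_eq_right hi, min_eq_right (show n ≤ i + 1 by omega)]
      exact hstrip_refl _ _
  · rw [chainWt]
    rcases lt_or_ge i n with hi | hi
    · have := h2 i (by omega)
      rw [IsZigzagStep, if_pos hi] at this
      simpa only [hfZ, min_eq_left hi.le, min_eq_left (show i + 1 ≤ n from hi)] using this.2
    · simp only [hfZ, min_eq_right hi, min_eq_right (show n ≤ i + 1 by omega)]
      rw [ribCount_self hr, hα i hi]
  · rw [chainWtV]
    rcases lt_or_ge i n with hi | hi
    · have := h2 (2 * n - 1 - i) (by omega)
      rw [IsZigzagStep, if_neg (by omega), show 2 * n - 1 - i + 1 = 2 * n - i by omega,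
        show 2 * n - 1 - (2 * n - 1 - i) = i by omega,
        show 2 * n - 1 - i = 2 * n - (i + 1) by omega] at this
      simpa only [hfZ, min_eq_left hi.le, min_eq_left (show i + 1 ≤ n from hi)] using this.2
    · simp only [hfZ, min_eq_right hi, min_eq_right (show n ≤ i + 1 by omega)]
      rw [revc_bits_eq_bits, ribCount_self hr, hβ i hi]
  · dsimp only
    rw [min_eq_right hi]
    congr 1
    omega
  · funext i
    rw [zigzagOfPair]
    split_ifs with hi
    · dsimp only
      rw [min_eq_left hi, boolSeq_eq_of_edgeSeq_eq (hfZ i)]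
    · dsimp only
      rw [min_eq_left (by omega), boolSeq_eq_of_edgeSeq_eq (hfZ _)]
      rcases le_total (2 * n) i with h | h
      · rw [h1 i h, h1 _ (by omega)]
      · rw [Nat.sub_sub_self h]

end

/-- The additive map sending `X ^ k` to `X ^ (k / 2)`. -/
noncomputable def halve : Polynomial ℕ →ₗ[ℕ] Polynomial ℕ :=
  Polynomial.lsum fun k => Polynomial.monomial (k / 2)

lemma halve_X_pow (k : ℕ) : halve (Polynomial.X ^ k) = Polynomial.X ^ (k / 2) := by
  rw [halve, Polynomial.X_pow_eq_monomial, Polynomial.X_pow_eq_monomial, Polynomial.lsum_apply,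
    Polynomial.sum_monomial_index]
  exact map_zero _

lemma halve_finsum_mem {ι : Type*} (s : Set ι) (f : ι → ℕ) :
    halve (∑ᶠ i ∈ s, Polynomial.X ^ f i) = ∑ᶠ i ∈ s, Polynomial.X ^ (f i / 2) := by
  have hsupp : ∀ g : ι → ℕ, (s ∩ Function.support fun i => (Polynomial.X : Polynomial ℕ) ^ g i) =
      s := fun g => Set.inter_eq_left.mpr fun i _ => (Polynomial.monic_X_pow _).ne_zero
  by_cases hs : s.Finite
  · rw [finsum_mem_eq_finite_toFinset_sum _ hs, finsum_mem_eq_finite_toFinset_sum _ hs, map_sum]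
    simp only [halve_X_pow]
  · rw [finsum_mem_eq_zero_of_infinite (by rwa [hsupp]),
      finsum_mem_eq_zero_of_infinite (by rwa [hsupp]), map_zero]

/-- The indicator matrix of a set of triples `(i, j, h)`, with entries in `{0, 1} ^ r`. -/
noncomputable def indicatorMatrix (T : Finset (ℕ × ℕ × ℕ)) (i j h : ℕ) : ℕ :=
  if (i, j, h) ∈ T then 1 else 0

section

variable {m n r : ℕ} {T : Finset (ℕ × ℕ × ℕ)}

lemma indicatorMatrix_eq_zero
    (hT : T ⊆ Finset.range m ×ˢ Finset.range n ×ˢ Finset.range r) {i j h : ℕ}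
    (hijh : ¬(i < m ∧ j < n ∧ h < r)) :
    indicatorMatrix T i j h = 0 := by
  refine if_neg fun hc => hijh ?_
  simpa using hT hc

lemma sum_indicatorMatrix_mul
    (hT : T ⊆ Finset.range m ×ˢ Finset.range n ×ˢ Finset.range r) (g : ℕ → ℕ → ℕ → ℕ) :
    ∑ i ∈ Finset.range m, ∑ j ∈ Finset.range n, ∑ h ∈ Finset.range r,
      indicatorMatrix T i j h * g i j h = ∑ x ∈ T, g x.1 x.2.1 x.2.2 := by
  simp only [← Finset.sum_product', indicatorMatrix, ite_mul, one_mul, zero_mul]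
  rw [Finset.sum_ite_mem, Finset.inter_eq_right.mpr hT]

lemma finsum_vnorm_indicatorMatrix_col
    (hT : T ⊆ Finset.range m ×ˢ Finset.range n ×ˢ Finset.range r) (j : ℕ) :
    ∑ᶠ i, vnorm r (indicatorMatrix T i j) = colCount T j := by
  rw [colCount, Finset.card_filter,
    ← sum_indicatorMatrix_mul hT fun _ j' _ => if j' = j then 1 else 0,
    finsum_eq_sum_of_support_subset (s := Finset.range m)]
  · refine Finset.sum_congr rfl fun i _ => ?_
    rw [Finset.sum_eq_single j]
    · simp [vnorm]
    · intro j' _ hj'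
      simp [hj']
    · intro hj
      rw [Finset.mem_range] at hj
      exact Finset.sum_eq_zero fun h _ => by
        rw [indicatorMatrix_eq_zero hT (by omega), zero_mul]
  · intro i hi
    rw [Finset.coe_range, Set.mem_Iio]
    by_contra hc
    exact hi (Finset.sum_eq_zero fun h _ => indicatorMatrix_eq_zero hT (by omega))

lemma finsum_vnorm_indicatorMatrix_row
    (hT : T ⊆ Finset.range m ×ˢ Finset.range n ×ˢ Finset.range r) (i : ℕ) :
    ∑ᶠ j, vnorm r (indicatorMatrix T i j) = rowCount T i := by
  rw [rowCount, Finset.card_filter,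
    ← sum_indicatorMatrix_mul hT fun i' _ _ => if i' = i then 1 else 0,
    finsum_eq_sum_of_support_subset (s := Finset.range n), Finset.sum_comm]
  · refine Finset.sum_congr rfl fun j _ => ?_
    rw [Finset.sum_eq_single i]
    · simp [vnorm]
    · intro i' _ hi'
      simp [hi']
    · intro hi
      rw [Finset.mem_range] at hi
      exact Finset.sum_eq_zero fun h _ => by
        rw [indicatorMatrix_eq_zero hT (by omega), zero_mul]
  · intro j hj
    rw [Finset.coe_range, Set.mem_Iio]
    by_contra hc
    exact hj (Finset.sum_eq_zero fun h _ => indicatorMatrix_eq_zero hT (by omega))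

lemma finsum_vcolor_indicatorMatrix
    (hT : T ⊆ Finset.range m ×ˢ Finset.range n ×ˢ Finset.range r) :
    ∑ᶠ i, ∑ᶠ j, vcolor r (indicatorMatrix T i j) = ∑ x ∈ T, x.2.2 := by
  have hz : ∀ i j, ¬(i < m ∧ j < n) → vcolor r (indicatorMatrix T i j) = 0 := fun i j hij =>
    Finset.sum_eq_zero fun h _ => by rw [indicatorMatrix_eq_zero hT (by tauto), mul_zero]
  rw [← sum_indicatorMatrix_mul hT fun _ _ h => h,
    finsum_eq_sum_of_support_subset (s := Finset.range m)]
  · refine Finset.sum_congr rfl fun i _ => ?_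
    rw [finsum_eq_sum_of_support_subset (s := Finset.range n)]
    · simp only [vcolor, mul_comm]
    · intro j hj
      rw [Finset.coe_range, Set.mem_Iio]
      by_contra hc
      exact hj (hz i j (by tauto))
  · intro i hi
    rw [Finset.coe_range, Set.mem_Iio]
    by_contra hc
    refine hi ?_
    simp only [hz i _ (fun h => hc h.1), finsum_zero]

end

/-- The matrices with finitely many nonzero entries, all of them in `{0, 1} ^ r`, with column sums
`α` and row sums `β`. -/
def bitMatrices (r : ℕ) (α β : ℕ → ℕ) : Set (ℕ → ℕ → ℕ → ℕ) :=
  {A | (∀ i j, Supported r (A i j)) ∧ (∀ i j h, A i j h ≤ 1) ∧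
    {p : ℕ × ℕ | A p.1 p.2 ≠ 0}.Finite ∧
    (∀ j, (∑ᶠ i : ℕ, vnorm r (A i j)) = α j) ∧ (∀ i, (∑ᶠ j : ℕ, vnorm r (A i j)) = β i)}

lemma eq_zero_of_finsum_vnorm_eq_zero {r : ℕ} {a : ℕ → ℕ → ℕ} (ha : ∀ i, Supported r (a i))
    (hfin : {i | a i ≠ 0}.Finite) (h : ∑ᶠ i, vnorm r (a i) = 0) (i : ℕ) : a i = 0 := by
  have hsupp : (Function.support fun i => vnorm r (a i)).Finite :=
    hfin.subset fun i hi h0 => hi (by simp [vnorm, h0])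
  have h1 := single_le_finsum i hsupp fun _ => Nat.zero_le _
  rw [h, Nat.le_zero, vnorm, Finset.sum_eq_zero_iff] at h1
  funext k
  rcases lt_or_ge k r with hk | hk
  · exact h1 k (Finset.mem_range.mpr hk)
  · exact ha i k hk

lemma bijOn_indicatorMatrix {r n : ℕ} {α β : ℕ → ℕ} (hα : ∀ i ≥ n, α i = 0)
    (hβ : ∀ i ≥ n, β i = 0) :
    Set.BijOn indicatorMatrix
      ((Finset.range n ×ˢ Finset.range n ×ˢ Finset.range r : Finset (ℕ × ℕ × ℕ)).powerset.filter
        fun T => (∀ i < n, rowCount T i = β i) ∧ ∀ j < n, colCount T j = α j : Finset _)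
      (bitMatrices r α β) := by
  refine ⟨fun T hT => ?_, fun T _ T' _ hTT => ?_, fun A hA => ?_⟩
  · rw [Finset.mem_coe, Finset.mem_filter, Finset.mem_powerset] at hT
    obtain ⟨hT, hrow, hcol⟩ := hT
    refine ⟨fun i j h hh => indicatorMatrix_eq_zero hT (by omega), fun i j h => ?_, ?_, fun j => ?_,
      fun i => ?_⟩
    · rw [indicatorMatrix]
      split_ifs <;> omega
    · refine (Finset.finite_toSet (Finset.range n ×ˢ Finset.range n)).subset fun p hp => ?_
      rw [Finset.mem_coe, Finset.mem_product, Finset.mem_range, Finset.mem_range]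
      by_contra hc
      exact hp (funext fun h => indicatorMatrix_eq_zero hT (by tauto))
    · rcases lt_or_ge j n with hj | hj
      · rw [finsum_vnorm_indicatorMatrix_col hT, hcol j hj]
      · rw [hα j hj]
        refine (finsum_congr fun i => ?_).trans finsum_zero
        exact Finset.sum_eq_zero fun h _ => indicatorMatrix_eq_zero hT (by omega)
    · rcases lt_or_ge i n with hi | hi
      · rw [finsum_vnorm_indicatorMatrix_row hT, hrow i hi]
      · rw [hβ i hi]
        refine (finsum_congr fun j => ?_).trans finsum_zero
        exact Finset.sum_eq_zero fun h _ => indicatorMatrix_eq_zero hT (by omega)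
  · ext ⟨i, j, h⟩
    have := congrFun (congrFun (congrFun hTT i) j) h
    simp only [indicatorMatrix] at this
    split_ifs at this <;> simp_all
  · obtain ⟨hsupp, hle, hfin, hcol, hrow⟩ := hA
    have hzero : ∀ i j h, ¬(i < n ∧ j < n ∧ h < r) → A i j h = 0 := by
      intro i j h hijh
      by_cases hj : n ≤ j
      · refine congrFun (eq_zero_of_finsum_vnorm_eq_zero (a := fun i => A i j) (fun i => hsupp i j)
          ((hfin.image Prod.fst).subset fun i hi => ⟨(i, j), hi, rfl⟩) ?_ i) h
        rw [hcol, hα j hj]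
      by_cases hi : n ≤ i
      · refine congrFun (eq_zero_of_finsum_vnorm_eq_zero (a := A i) (hsupp i)
          ((hfin.image Prod.snd).subset fun j hj => ⟨(i, j), hj, rfl⟩) ?_ j) h
        rw [hrow, hβ i hi]
      exact hsupp i j h (by omega)
    set T := (Finset.range n ×ˢ Finset.range n ×ˢ Finset.range r : Finset (ℕ × ℕ × ℕ)).filter
      fun x => A x.1 x.2.1 x.2.2 = 1 with hTdef
    have hT : T ⊆ Finset.range n ×ˢ Finset.range n ×ˢ Finset.range r := Finset.filter_subset _ _
    have hTA : indicatorMatrix T = A := by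
      funext i j h
      rw [indicatorMatrix]
      have h1 := hle i j h
      have h2 := hzero i j h
      simp only [hTdef, Finset.mem_filter, Finset.mem_product, Finset.mem_range]
      split_ifs with h3
      · exact h3.2.symm
      · by_contra hc
        exact h3 ⟨by_contra fun h4 => hc (h2 h4).symm, by omega⟩
    refine ⟨T, ?_, hTA⟩
    rw [Finset.mem_coe, Finset.mem_filter, Finset.mem_powerset]
    refine ⟨hT, fun i _ => ?_, fun j _ => ?_⟩
    · rw [← finsum_vnorm_indicatorMatrix_row hT, hTA, hrow]
    · rw [← finsum_vnorm_indicatorMatrix_col hT, hTA, hcol]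

lemma finsum_mem_tableauPairs {r : ℕ} (hr : 1 ≤ r) {γ : ℕ → ℕ} (hγ : IsPartition γ)
    (hcore : ∀ k : ℤ, ¬(edgeSeq γ (k - r) = 0 ∧ edgeSeq γ k = 1)) {n K : ℕ} {α β : ℕ → ℕ}
    (hα : ∀ i ≥ n, α i = 0) (hβ : ∀ i ≥ n, β i = 0) (hK : ∀ i, α i ≤ K) :
    ∑ᶠ PQ ∈ tableauPairs r γ α β,
      (Polynomial.X : Polynomial ℕ) ^ (chainTwoSpin r PQ.1 + chainTwoSpinV r PQ.2) =
    ∑ T ∈ (Finset.range n ×ˢ Finset.range n ×ˢ Finset.range r : Finset (ℕ × ℕ × ℕ)).powerset.filter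
      fun T => (∀ i < n, rowCount T i = β i) ∧ ∀ j < n, colCount T j = α j, tripleWt T := by
  obtain ⟨M, hM, -⟩ := balancedBy_of_edgeSeq hγ (bits_boolSeq γ)
  have hcore' : ∀ k, ¬(boolSeq γ (k - r) = false ∧ boolSeq γ k = true) := fun k hk => by
    refine hcore k ⟨?_, ?_⟩
    · rw [← bits_boolSeq, bits_eq_zero, hk.1]
    · rw [← bits_boolSeq, bits_eq_one, hk.2]
  set C : ℕ := M + r * K * (2 * n) + r with hC
  have hC1 : (C : ℤ) = M + r * K * (2 * n : ℕ) + r := by rw [hC]; push_cast; ring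
  have hC2 : (r : ℤ) * K * n ≤ r * K * (2 * n : ℕ) := by
    gcongr
    omega
  rw [finsum_mem_eq_of_bijOn (g := fun Z : ℕ → ℤ → Bool => (Polynomial.X : Polynomial ℕ) ^
      ∑ i ∈ Finset.range (2 * n), zigzagTwoSpin r n i (Z i) (Z (i + 1))) (zigzagOfPair n)
    ⟨fun _ h => zigzagOfPair_mem hα hβ h, zigzagOfPair_injOn hα hβ,
      zigzagOfPair_surjOn hr hγ hα hβ hK⟩
    fun _ h => by rw [← sum_zigzagTwoSpin_zigzagOfPair hα hβ h],
    ← iterApply_zigzagOp hr (l := -C - 1) (N := 2 * C) hK hM (by omega) (by push_cast at *; omega),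
    ← revApply_iterApply_eq_zigzag, revApply_iterApply_core r hr _ _ hcore' _ (K := K) (by omega)
      (fun j => by exact_mod_cast hK j) hM n n (by omega) (by push_cast at *; omega),
    Finset.sum_filter]
  simp only [Nat.cast_inj]

/-- The dual (asymmetric) `q`-Cauchy identity
`Σ_λ G_λ(q^{1/2},X) G̃_λ(q^{1/2},Y) = Π_{i,j} Π_{k<r} (1 + q^k X_i Y_j)`, stated
coefficientwise: for all exponent vectors `α, β`, the sum of `q^{spin P + spinᵛ Q}`
over pairs of a semistandard and a transpose semistandard `r`-ribbon tableau of equal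
shape with weights `α, β` equals the sum of `q^{Σ n(A_{ij})}` over matrices `A` with
entries in `{0,1}ʳ`, column sums of `|·|` equal to `α` and row sums equal to `β`. -/
theorem stmt18 (r : ℕ) (hr : 1 ≤ r) (γ : ℕ → ℕ) (hγ : IsPartition γ)
    (hcore : ∀ k : ℤ, ¬(edgeSeq γ (k - r) = 0 ∧ edgeSeq γ k = 1))
    (α β : ℕ →₀ ℕ) :
    (∑ᶠ PQ ∈ {PQ : (ℕ → ℕ → ℕ) × (ℕ → ℕ → ℕ) |
        IsSSRT r γ PQ.1 ∧ IsTSSRT r γ PQ.2 ∧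
        (∀ i, chainWt r PQ.1 i = α i) ∧ (∀ i, chainWtV r PQ.2 i = β i) ∧
        ∃ N : ℕ, ∀ i : ℕ, N ≤ i → PQ.1 i = PQ.2 i},
      (Polynomial.X : Polynomial ℕ) ^ ((chainTwoSpin r PQ.1 + chainTwoSpinV r PQ.2) / 2))
    = ∑ᶠ A ∈ {A : ℕ → ℕ → ℕ → ℕ |
        (∀ i j, Supported r (A i j)) ∧ (∀ i j h, A i j h ≤ 1) ∧
        {p : ℕ × ℕ | A p.1 p.2 ≠ 0}.Finite ∧
        (∀ j, (∑ᶠ i : ℕ, vnorm r (A i j)) = α j) ∧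
        (∀ i, (∑ᶠ j : ℕ, vnorm r (A i j)) = β i)},
      (Polynomial.X : Polynomial ℕ) ^ (∑ᶠ i : ℕ, ∑ᶠ j : ℕ, vcolor r (A i j)) := by
  obtain ⟨n, hn⟩ : ∃ n, ∀ i ≥ n, α i = 0 ∧ β i = 0 := by
    refine ⟨(α.support ∪ β.support).sup id + 1, fun i hi => ?_⟩
    by_contra hc
    have : i ∈ α.support ∪ β.support := by
      simp only [Finset.mem_union, Finsupp.mem_support_iff]
      tauto
    have := Finset.le_sup (f := id) this
    simp only [id] at this
    omega
  obtain ⟨K, hK⟩ : ∃ K, ∀ i, α i ≤ K := by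
    refine ⟨∑ i ∈ α.support, α i, fun i => ?_⟩
    by_cases hi : i ∈ α.support
    · exact Finset.single_le_sum (fun _ _ => Nat.zero_le _) hi
    · rw [Finsupp.notMem_support_iff.mp hi]
      exact Nat.zero_le _
  have hα := fun i hi => (hn i hi).1
  have hβ := fun i hi => (hn i hi).2
  have h := congrArg halve (finsum_mem_tableauPairs hr hγ hcore hα hβ hK)
  rw [halve_finsum_mem, map_sum] at h
  refine h.trans ?_
  rw [← finsum_mem_coe_finset]
  refine finsum_mem_eq_of_bijOn indicatorMatrix (bijOn_indicatorMatrix hα hβ) fun T hT => ?_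
  rw [Finset.mem_coe, Finset.mem_filter, Finset.mem_powerset] at hT
  rw [tripleWt, halve_X_pow, finsum_vcolor_indicatorMatrix hT.1, Nat.mul_div_cancel_left _ two_pos]
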